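/- arXiv:2601.13332 — 3 statements merged into one kernel-verified Lean document; each statement's English description precedes it below -/
import Mathlib

section
/- Let ℓ > 0 and S := {z ∈ ℂ : 0 < Im z < π}. Let ψ : S → ℂ be holomorphic, zero-free and ℓ-periodic (ψ(z+ℓ) = ψ(z) for all z with z, z+ℓ ∈ S), and assume that for some y₀ ∈ (0,π) the closed loop t ∈ [0,ℓ] ↦ ψ(t+iy₀) has winding number 0 around the origin. Let f : S → ℂ be holomorphic with f(z+ℓ) = −f(z) for all z with z, z+ℓ ∈ S, and assume: (i) Re f extends continuously to S ∪ ℝ and vanishes on ℝ; (ii) there exist ε ∈ (0,π) and a holomorphic function g on S_ε := {z ∈ ℂ : π−ε < Im z < π} such that g′ = f·ψ on S_ε, g(z+ℓ) = −g(z) for all z with z, z+ℓ ∈ S_ε, and Im g extends continuously to S_ε ∪ {Im z = π} and vanishes on the line {Im z = π}. Then f ≡ 0 on S. -/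
open Complex

noncomputable section

/-- Jacobi theta function `θ₁(w;τ)` with nome `q = exp(iπτ)`. -/
def theta1 (τ w : ℂ) : ℂ :=
  -Complex.I * ∑' n : ℤ, (-1 : ℂ) ^ n *
    Complex.exp (Real.pi * Complex.I * τ * ((n : ℂ) + 1 / 2) ^ 2) *
    Complex.exp ((2 * (n : ℂ) + 1) * Real.pi * Complex.I * w)

/-- Jacobi theta function `θ₃(w;τ)` with nome `q = exp(iπτ)`. -/
def theta3 (τ w : ℂ) : ℂ :=
  ∑' n : ℤ, Complex.exp (Real.pi * Complex.I * τ * (n : ℂ) ^ 2) *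
    Complex.exp (2 * Real.pi * Complex.I * (n : ℂ) * w)

/-- The modulus `τ = 2πi/ℓ`. -/
def tau (ℓ : ℝ) : ℂ := 2 * Real.pi * Complex.I / (ℓ : ℂ)

/-- The function `g_μ(w) = (2/(πi))·θ₁′(0;τ)·θ₃(w+μ;τ)/(θ₃(μ;τ)·θ₁(w;τ))` with `τ = 2πi/ℓ`. -/
def gmu (ℓ μ : ℝ) (w : ℂ) : ℂ :=
  2 / (Real.pi * Complex.I) * deriv (theta1 (tau ℓ)) 0 * theta3 (tau ℓ) (w + (μ : ℂ)) /
    (theta3 (tau ℓ) (μ : ℂ) * theta1 (tau ℓ) w)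

/-- The function `f_μ(z) = ℓ⁻¹ g_μ(z/ℓ)`. -/
def fmu (ℓ μ : ℝ) (z : ℂ) : ℂ := (ℓ : ℂ)⁻¹ * gmu ℓ μ (z / (ℓ : ℂ))

/-- The lattice `{m ω₁ + n ω₂ : m, n ∈ ℤ}`. -/
def lat (ω₁ ω₂ : ℂ) : Set ℂ := {z : ℂ | ∃ m n : ℤ, z = (m : ℂ) * ω₁ + (n : ℂ) * ω₂}

/-- The Weierstrass `℘`-function for the lattice spanned by `ω₁, ω₂`:
`℘(z) = z⁻² + ∑_{ω ∈ Λ∖{0}} ((z−ω)⁻² − ω⁻²)`. -/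
def wp (ω₁ ω₂ : ℂ) (z : ℂ) : ℂ :=
  1 / z ^ 2 + ∑' p : {p : ℤ × ℤ // p ≠ 0},
    (1 / (z - ((p.1.1 : ℂ) * ω₁ + (p.1.2 : ℂ) * ω₂)) ^ 2
      - 1 / ((p.1.1 : ℂ) * ω₁ + (p.1.2 : ℂ) * ω₂) ^ 2)

/-- The point `z_μ = (1/2 − μ)ℓ + πi`. -/
def zmu (ℓ μ : ℝ) : ℂ := (1 / 2 - (μ : ℂ)) * (ℓ : ℂ) + Real.pi * Complex.I

open scoped Classical in
/-- The cycle sum `∑_{σ ∈ Cₙ} ∏_{k=1}^n f(z_{σ(k)} − z_k)`, where `Cₙ` is the set of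
permutations of `{1,…,n}` consisting of a single `n`-cycle. -/
def cycleSum (n : ℕ) (f : ℂ → ℂ) (z : Fin n → ℂ) : ℂ :=
  ∑ σ ∈ Finset.univ.filter
      (fun σ : Equiv.Perm (Fin n) => σ.IsCycle ∧ σ.support = Finset.univ),
    ∏ k : Fin n, f (z (σ k) - z k)

/-- The open horizontal strip `S = {0 < Im z < π}`. -/
def strip : Set ℂ := {z : ℂ | 0 < z.im ∧ z.im < Real.pi}

/-- The top substrip `S_ε = {π − ε < Im z < π}`. -/
def topStrip (ε : ℝ) : Set ℂ := {z : ℂ | Real.pi - ε < z.im ∧ z.im < Real.pi}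

end

section Helpers

open Complex Metric Set Filter Topology

lemma ann_connected {a b : ℝ} (ha : 0 < a) (hab : a < b) :
    IsConnected {w : ℂ | a < ‖w‖ ∧ ‖w‖ < b} := by
  have hb : 0 < b := ha.trans hab
  have h1 : IsConnected {z : ℂ | Real.log a < z.re ∧ z.re < Real.log b} := by
    have hc : Convex ℝ {z : ℂ | Real.log a < z.re ∧ z.re < Real.log b} :=
      (convex_halfSpace_re_gt _).inter (convex_halfSpace_re_lt _)
    refine ⟨?_, hc.isPreconnected⟩
    refine ⟨(((Real.log a + Real.log b) / 2 : ℝ) : ℂ), ?_⟩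
    have := Real.log_lt_log ha hab
    simp only [mem_ofPred_eq, ofReal_re]
    constructor <;> linarith
  have h2 := h1.image Complex.exp Complex.continuous_exp.continuousOn
  convert h2 using 1
  ext w
  constructor
  · rintro ⟨h3, h4⟩
    have hw : 0 < ‖w‖ := ha.trans h3
    refine ⟨Complex.log w, ?_, Complex.exp_log (norm_pos_iff.1 hw)⟩
    simp only [mem_ofPred_eq, Complex.log_re]
    exact ⟨Real.log_lt_log ha h3, Real.log_lt_log hw h4⟩
  · rintro ⟨z, ⟨h3, h4⟩, rfl⟩
    simp only [mem_ofPred_eq, Complex.norm_exp]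
    exact ⟨(Real.log_lt_iff_lt_exp ha).1 h3, (Real.lt_log_iff_exp_lt hb).1 h4⟩

lemma ann_open (a b : ℝ) : IsOpen {w : ℂ | a < ‖w‖ ∧ ‖w‖ < b} :=
  (isOpen_lt continuous_const continuous_norm).inter (isOpen_lt continuous_norm continuous_const)

lemma argmono {a b R1 R2 : ℝ} (ha : 0 < a) (h1 : a < R1) (h12 : R1 ≤ R2) (h2 : R2 < b)
    (G : ℂ → ℂ) (hG : DifferentiableOn ℂ G {w : ℂ | a < ‖w‖ ∧ ‖w‖ < b})
    (hz1 : ∀ w : ℂ, ‖w‖ = R1 → G w ≠ 0) (hz2 : ∀ w : ℂ, ‖w‖ = R2 → G w ≠ 0) :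
    (∮ w in C(0, R1), logDeriv G w).im ≤ (∮ w in C(0, R2), logDeriv G w).im := by
  have hR1 : 0 < R1 := ha.trans h1
  have hR2 : 0 < R2 := hR1.trans_le h12
  set A := {w : ℂ | a < ‖w‖ ∧ ‖w‖ < b} with hA
  have hAo : IsOpen A := ann_open a b
  have hGA : AnalyticOnNhd ℂ G A := hG.analyticOnNhd hAo
  -- compact annulus
  set a' := (a + R1) / 2 with ha'
  set b' := (R2 + b) / 2 with hb'
  set U : Set ℂ := {w : ℂ | a' ≤ ‖w‖ ∧ ‖w‖ ≤ b'} with hU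
  have hUA : U ⊆ A := by
    rintro w ⟨h3, h4⟩
    exact ⟨by linarith, by linarith⟩
  have hUc : IsCompact U := by
    have : U = closedBall (0:ℂ) b' ∩ {w : ℂ | a' ≤ ‖w‖} := by
      ext w; simp [hU, and_comm]
    rw [this]
    exact (isCompact_closedBall _ _).inter_right (isClosed_le continuous_const continuous_norm)
  have hmA : MeromorphicOn G A := hGA.meromorphicOn
  have hordA : ∀ u : A, meromorphicOrderAt G u ≠ ⊤ := by
    rw [← hmA.exists_meromorphicOrderAt_ne_top_iff_forall (ann_connected ha (by linarith))]
    have hn : ‖(R1 : ℂ)‖ = R1 := by simp [abs_of_pos hR1]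
    have hmem : (R1 : ℂ) ∈ A := ⟨by rw [hn]; exact h1, by rw [hn]; linarith⟩
    refine ⟨⟨(R1 : ℂ), hmem⟩, ?_⟩
    have h0 := (hGA _ hmem).analyticOrderAt_eq_zero.2 (hz1 _ hn)
    rw [(hGA _ hmem).meromorphicOrderAt_eq, h0]
    simp
  have hGU : AnalyticOnNhd ℂ G U := hGA.mono hUA
  have hmU : MeromorphicOn G U := hGU.meromorphicOn
  have hfin := (MeromorphicOn.divisor G U).finiteSupport hUc
  obtain ⟨g, hg, hg0, hfac⟩ := hmU.extract_zeros_poles (fun u => hordA ⟨u, hUA u.2⟩) hfin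
  set D := MeromorphicOn.divisor G U with hD
  have hD0 : ∀ u, 0 ≤ D u := fun u => MeromorphicOn.AnalyticOnNhd.divisor_nonneg hGU u
  set s := hfin.toFinset with hs
  have hprod : (∏ᶠ u, (· - u) ^ D u : ℂ → ℂ) = fun x => ∏ u ∈ s, (x - u) ^ D u := by
    rw [Function.FactorizedRational.finprod_eq_fun hfin]
    funext x
    apply finprod_eq_prod_of_mulSupport_subset
    intro u hu
    simp only [hs, Finite.coe_toFinset, Function.mem_support]
    intro h
    apply hu
    simp [h]
  rw [hprod] at hfac
  have hsU : ∀ u ∈ s, u ∈ U := by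
    intro u hu
    have : u ∈ D.support := by simpa [hs] using hu
    exact D.supportWithinDomain this
  have hsG : ∀ u ∈ s, G u = 0 := by
    intro u hu
    by_contra hne
    have h3 : D u ≠ 0 := by simpa [hs] using hu
    apply h3
    rw [hD, MeromorphicOn.divisor_apply hmU (hsU u hu)]
    have h0 := (hGU u (hsU u hu)).analyticOrderAt_eq_zero.2 hne
    rw [(hGU u (hsU u hu)).meromorphicOrderAt_eq, h0]
    simp
  have hloc : ∀ x : ℂ, a' < ‖x‖ → ‖x‖ < b' →
      G =ᶠ[𝓝 x] fun x => (∏ u ∈ s, (x - u) ^ D u) * g x := by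
    intro x hx1 hx2
    have hxU : x ∈ U := ⟨hx1.le, hx2.le⟩
    have hUn : U ∈ 𝓝 x := by
      filter_upwards [(ann_open a' b').mem_nhds ⟨hx1, hx2⟩] with y hy
      exact ⟨hy.1.le, hy.2.le⟩
    have han : AnalyticAt ℂ (fun x => (∏ u ∈ s, (x - u) ^ D u) * g x) x := by
      refine AnalyticAt.mul ?_ (hg x hxU)
      apply Finset.analyticAt_fun_prod
      intro u _
      obtain ⟨n, hn⟩ := Int.eq_ofNat_of_zero_le (hD0 u)
      simp only [hn, zpow_natCast]
      fun_prop
    refine ((hGU x hxU).frequently_eq_iff_eventually_eq han).1 ?_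
    apply Filter.Eventually.frequently
    have h3 : {y | G y = ((fun x => ∏ u ∈ s, (x - u) ^ D u) • g) y} ∈ codiscreteWithin U := hfac
    rw [mem_codiscreteWithin] at h3
    have h4 := h3 x hxU
    rw [disjoint_principal_right] at h4
    filter_upwards [h4, mem_nhdsWithin_of_mem_nhds hUn] with y hy hyU
    simp only [mem_compl_iff, Set.mem_sdiff, not_and, not_not] at hy
    simpa using hy hyU
  have hld : ∀ x : ℂ, a' < ‖x‖ → ‖x‖ < b' → G x ≠ 0 →
      logDeriv G x = (∑ u ∈ s, (D u : ℂ) * (x - u)⁻¹) + logDeriv g x := by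
    intro x hx1 hx2 hGx
    have hne : ∀ u ∈ s, x - u ≠ 0 := by
      intro u hu h
      rw [sub_eq_zero] at h
      exact hGx (h ▸ hsG u hu)
    have h3 := hloc x hx1 hx2
    have hd : ∀ u ∈ s, DifferentiableAt ℂ (fun x => (x - u) ^ D u) x := by
      intro u hu
      exact (differentiableAt_id.sub_const u).zpow (Or.inl (hne u hu))
    have h4 : logDeriv G x = logDeriv (fun x => (∏ u ∈ s, (x - u) ^ D u) * g x) x := by
      rw [logDeriv_apply, logDeriv_apply, h3.deriv_eq, h3.self_of_nhds]
    rw [h4, logDeriv_mul, logDeriv_prod]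
    · congr 1
      apply Finset.sum_congr rfl
      intro u hu
      rw [logDeriv_fun_zpow (by fun_prop)]
      simp [logDeriv_apply]
    · intro u hu
      exact zpow_ne_zero _ (hne u hu)
    · exact hd
    · exact Finset.prod_ne_zero_iff.2 fun u hu => zpow_ne_zero _ (hne u hu)
    · exact hg0 ⟨x, hx1.le, hx2.le⟩
    · exact DifferentiableAt.fun_finsetProd hd
    · exact (hg x ⟨hx1.le, hx2.le⟩).differentiableAt
  have hlg : ∀ x ∈ U, AnalyticAt ℂ (logDeriv g) x := by
    intro x hx
    exact (hg x hx).deriv.div (hg x hx) (hg0 ⟨x, hx⟩)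
  have hcirc : ∀ R : ℝ, R1 ≤ R → R ≤ R2 → (∀ w : ℂ, ‖w‖ = R → G w ≠ 0) →
      (∮ w in C(0, R), logDeriv G w) =
        (∑ u ∈ s, (D u : ℂ) * ∮ w in C(0, R), (w - u)⁻¹) + ∮ w in C(0, R), logDeriv g w := by
    intro R hR hR' hzR
    have hRp : 0 ≤ R := by linarith
    have hne : ∀ u ∈ s, ∀ w ∈ sphere (0:ℂ) R, w - u ≠ 0 := by
      intro u hu w hw h
      rw [sub_eq_zero] at h
      exact hzR w (by simpa using hw) (h ▸ hsG u hu)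
    have hi : ∀ u ∈ s, CircleIntegrable (fun w => (D u : ℂ) * (w - u)⁻¹) 0 R := by
      intro u hu
      refine ContinuousOn.circleIntegrable hRp ?_
      exact continuousOn_const.mul ((by fun_prop : ContinuousOn (fun w : ℂ => w - u) _).inv₀ (hne u hu))
    have hig : CircleIntegrable (logDeriv g) 0 R := by
      refine ContinuousOn.circleIntegrable hRp ?_
      intro w hw
      have : ‖w‖ = R := by simpa using hw
      exact (hlg w ⟨by linarith, by linarith⟩).continuousAt.continuousWithinAt
    rw [circleIntegral.integral_congr (g := fun w => (∑ u ∈ s, (D u : ℂ) * (w - u)⁻¹) + logDeriv g w) hRp]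
    · rw [circleIntegral.integral_add _ hig, circleIntegral.integral_fun_sum hi]
      · simp only [circleIntegral.integral_const_mul]
      · exact CircleIntegrable.fun_sum s hi
    · intro w hw
      have : ‖w‖ = R := by simpa using hw
      exact hld w (by linarith) (by linarith) (hzR w this)
  have hgg : (∮ w in C(0, R2), logDeriv g w) = ∮ w in C(0, R1), logDeriv g w := by
    refine circleIntegral_eq_of_differentiable_on_annulus_off_countable hR1 h12 countable_empty ?_ ?_
    · intro w hw
      have h3 : ‖w‖ ≤ R2 ∧ R1 ≤ ‖w‖ := by simpa using hw
      exact (hlg w ⟨by linarith, by linarith⟩).continuousAt.continuousWithinAt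
    · intro w hw
      have h3 : ‖w‖ < R2 ∧ R1 < ‖w‖ := by simpa using hw
      exact (hlg w ⟨by linarith, by linarith⟩).differentiableAt
  rw [hcirc R1 le_rfl h12 hz1, hcirc R2 h12 le_rfl hz2, hgg, add_im, add_im, im_sum, im_sum]
  gcongr with u hu
  have hDr : ∀ x : ℂ, ((D u : ℂ) * x).im = (D u : ℝ) * x.im := by
    intro x
    rw [← ofReal_intCast, im_ofReal_mul]
  have hDn : (0:ℝ) ≤ (D u : ℝ) := by exact_mod_cast hD0 u
  rw [hDr, hDr]
  refine mul_le_mul_of_nonneg_left ?_ hDn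
  have hout : ∀ R : ℝ, 0 < R → R < ‖u‖ → (∮ w in C(0, R), (w - u)⁻¹) = 0 := by
    intro R hR hu
    have hd : ∀ w ∈ closedBall (0:ℂ) R, DifferentiableAt ℂ (fun w => (w - u)⁻¹) w := by
      intro w hw
      refine DifferentiableAt.inv (by fun_prop) ?_
      intro h
      rw [sub_eq_zero] at h
      have : ‖w‖ ≤ R := by simpa using hw
      rw [h] at this
      linarith
    refine circleIntegral_eq_zero_of_differentiable_on_off_countable hR.le countable_empty ?_ ?_
    · exact fun w hw => (hd w hw).continuousAt.continuousWithinAt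
    · exact fun w hw => hd w (ball_subset_closedBall hw.1)
  have hin : ∀ R : ℝ, ‖u‖ < R → (∮ w in C(0, R), (w - u)⁻¹) = 2 * Real.pi * I := by
    intro R hu
    exact circleIntegral.integral_sub_inv_of_mem_ball (by simpa using hu)
  have hpi : (0:ℝ) ≤ (2 * (Real.pi : ℂ) * I).im := by
    simp [Real.pi_pos.le]
  rcases lt_trichotomy ‖u‖ R1 with h | h | h
  · rw [hin R1 h, hin R2 (by linarith)]
  · exact absurd (hsG u hu) (hz1 u h)
  · rw [hout R1 hR1 h]
    rcases lt_trichotomy ‖u‖ R2 with h' | h' | h'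
    · rw [hin R2 h']; simpa using Real.pi_pos.le
    · exact absurd (hsG u hu) (hz2 u h')
    · rw [hout R2 hR2 h']

lemma cauchy_diff {R : ℝ} (hR : 0 < R) (F : ℂ → ℂ) (hF : ContinuousOn F (sphere 0 R)) :
    DifferentiableOn ℂ (fun w => (2 * Real.pi * I : ℂ)⁻¹ • ∮ z in C(0, R), (z - w)⁻¹ • F z)
      (ball 0 R) := by
  lift R to NNReal using hR.le
  have h := hasFPowerSeriesOn_cauchy_integral (hF.circleIntegrable hR.le) (by exact_mod_cast hR)
  have h2 := h.differentiableOn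
  rwa [Metric.eball_coe] at h2

lemma cauchy_ann {a r R : ℝ} (ha : 0 < a) (har : a < r) (hR : R < 1) (G : ℂ → ℂ)
    (hG : DifferentiableOn ℂ G {w : ℂ | a < ‖w‖ ∧ ‖w‖ < 1}) {w : ℂ} (h1 : r < ‖w‖) (h2 : ‖w‖ < R) :
    G w = (2 * Real.pi * I : ℂ)⁻¹ • (∮ z in C(0, R), (z - w)⁻¹ • G z)
      - (2 * Real.pi * I : ℂ)⁻¹ • ∮ z in C(0, r), (z - w)⁻¹ • G z := by
  have hAo := ann_open a 1
  have hwA : w ∈ {w : ℂ | a < ‖w‖ ∧ ‖w‖ < 1} := ⟨by linarith, by linarith⟩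
  have hds : DifferentiableOn ℂ (dslope G w) {w : ℂ | a < ‖w‖ ∧ ‖w‖ < 1} :=
    (Complex.differentiableOn_dslope (hAo.mem_nhds hwA)).2 hG
  have hr : 0 < r := ha.trans har
  have heq : (∮ z in C(0, R), dslope G w z) = ∮ z in C(0, r), dslope G w z := by
    refine circleIntegral_eq_of_differentiable_on_annulus_off_countable hr (by linarith)
      countable_empty ?_ ?_
    · refine hds.continuousOn.mono ?_
      intro z hz
      have h3 : ‖z‖ ≤ R ∧ r ≤ ‖z‖ := by simpa using hz
      exact ⟨by linarith, by linarith⟩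
    · intro z hz
      have h3 : ‖z‖ < R ∧ r < ‖z‖ := by simpa using hz
      exact hds.differentiableAt (hAo.mem_nhds ⟨by linarith, by linarith⟩)
  have hsplit : ∀ ρ : ℝ, r ≤ ρ → ρ ≤ R → ρ ≠ ‖w‖ → (∮ z in C(0, ρ), dslope G w z) =
      (∮ z in C(0, ρ), (z - w)⁻¹ • G z) - (∮ z in C(0, ρ), (z - w)⁻¹) * G w := by
    intro ρ hρ hρ' hne
    have hρ0 : 0 ≤ ρ := by linarith
    have hzw : ∀ z ∈ sphere (0:ℂ) ρ, z - w ≠ 0 := by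
      intro z hz h
      rw [sub_eq_zero] at h
      have : ‖z‖ = ρ := by simpa using hz
      rw [h] at this
      exact hne this.symm
    have hci : ContinuousOn (fun z => (z - w)⁻¹) (sphere (0:ℂ) ρ) :=
      (by fun_prop : ContinuousOn (fun z : ℂ => z - w) _).inv₀ hzw
    have hcG : ContinuousOn G (sphere (0:ℂ) ρ) := by
      refine hG.continuousOn.mono ?_
      intro z hz
      have : ‖z‖ = ρ := by simpa using hz
      exact ⟨by linarith, by linarith⟩
    have e1 : (∮ z in C(0, ρ), (z - w)⁻¹) * G w = ∮ z in C(0, ρ), (z - w)⁻¹ • G w := by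
      rw [circleIntegral.integral_smul_const]; rfl
    have i1 : CircleIntegrable (fun z => (z - w)⁻¹ • G z) 0 ρ := (hci.smul hcG).circleIntegrable hρ0
    have i2 : CircleIntegrable (fun z => (z - w)⁻¹ • G w) 0 ρ :=
      (hci.smul continuousOn_const).circleIntegrable hρ0
    rw [e1, ← circleIntegral.integral_sub i1 i2]
    refine circleIntegral.integral_congr hρ0 ?_
    intro z hz
    have : z ≠ w := sub_ne_zero.1 (hzw z hz)
    simp only
    rw [dslope_of_ne _ this, slope_def_module]
    simp only [smul_eq_mul]
    ring
  have hout : (∮ z in C(0, r), (z - w)⁻¹) = 0 := by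
    have hd : ∀ z ∈ closedBall (0:ℂ) r, DifferentiableAt ℂ (fun z => (z - w)⁻¹) z := by
      intro z hz
      refine DifferentiableAt.inv (by fun_prop) ?_
      intro h
      rw [sub_eq_zero] at h
      have : ‖z‖ ≤ r := by simpa using hz
      rw [h] at this
      linarith
    refine circleIntegral_eq_zero_of_differentiable_on_off_countable hr.le countable_empty ?_ ?_
    · exact fun w hw => (hd w hw).continuousAt.continuousWithinAt
    · exact fun w hw => hd w (ball_subset_closedBall hw.1)
  rw [hsplit R (by linarith) le_rfl (by linarith), hsplit r le_rfl (by linarith) (by linarith), hout,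
    circleIntegral.integral_sub_inv_of_mem_ball (by simpa using h2)] at heq
  have hpi := Complex.two_pi_I_ne_zero
  rw [← smul_sub, smul_eq_mul, eq_inv_mul_iff_mul_eq₀ hpi]
  linear_combination -heq

lemma re_max {R R' δ : ℝ} (hR' : 0 < R') (hRR : R' < R) (P : ℂ → ℂ)
    (hP : DifferentiableOn ℂ P (ball 0 R)) (hb : ∀ w : ℂ, ‖w‖ = R' → |(P w).re| ≤ δ) :
    ∀ w : ℂ, ‖w‖ ≤ R' → |(P w).re| ≤ δ := by
  have key : ∀ Q : ℂ → ℂ, DifferentiableOn ℂ Q (ball 0 R) → (∀ w : ℂ, ‖w‖ = R' → (Q w).re ≤ δ) →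
      ∀ w : ℂ, ‖w‖ ≤ R' → (Q w).re ≤ δ := by
    intro Q hQ hQb w hw
    have hd : DiffContOnCl ℂ (fun z => exp (Q z)) (ball 0 R') := by
      refine DifferentiableOn.diffContOnCl ?_
      rw [closure_ball _ hR'.ne']
      exact (hQ.mono (closedBall_subset_ball hRR)).cexp
    have := Complex.norm_le_of_forall_mem_frontier_norm_le isBounded_ball hd (C := Real.exp δ) ?_
      (z := w) ?_
    · rwa [Complex.norm_exp, Real.exp_le_exp] at this
    · intro z hz
      rw [frontier_ball _ hR'.ne'] at hz
      rw [Complex.norm_exp, Real.exp_le_exp]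
      exact hQb z (by simpa using hz)
    · rw [closure_ball _ hR'.ne']; simpa using hw
  intro w hw
  rw [abs_le]
  constructor
  · have := key (fun z => -P z) hP.neg (fun z hz => by
      have := (abs_le.1 (hb z hz)).1
      simp only [neg_re]; linarith) w hw
    simp only [neg_re] at this
    linarith
  · exact key P hP (fun z hz => (abs_le.1 (hb z hz)).2) w hw

open ComplexConjugate in
lemma reflect_key {r : ℝ} (hr : 0 < r) (G : ℂ → ℂ) (hG : ContinuousOn G (sphere 0 r)) {w : ℂ}
    (hw : r < ‖w‖) :
    conj ((2 * Real.pi * I : ℂ)⁻¹ • ∮ z in C(0, r⁻¹), (z - (conj w)⁻¹)⁻¹ • conj (G (conj z)⁻¹)) =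
      (2 * Real.pi * I : ℂ)⁻¹ • (∮ z in C(0, r), z⁻¹ • G z)
      - (2 * Real.pi * I : ℂ)⁻¹ • ∮ z in C(0, r), (z - w)⁻¹ • G z := by
  have hz0 : ∀ z ∈ sphere (0:ℂ) r, z ≠ 0 := by
    rintro z hz rfl
    simp at hz; linarith
  have hzw : ∀ z ∈ sphere (0:ℂ) r, z - w ≠ 0 := by
    intro z hz h
    rw [sub_eq_zero] at h
    have : ‖z‖ = r := by simpa using hz
    rw [h] at this
    linarith
  have hw0 : w ≠ 0 := by
    rintro rfl
    simp at hw; linarith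
  rw [← smul_sub, ← circleIntegral.integral_sub]
  rotate_left
  · exact ((continuousOn_id.inv₀ hz0).smul hG).circleIntegrable hr.le
  · exact (((by fun_prop : ContinuousOn (fun z : ℂ => z - w) _).inv₀ hzw).smul hG).circleIntegrable hr.le
  simp only [circleIntegral, smul_eq_mul, map_mul]
  rw [← intervalIntegral.integral_const_mul, ← intervalIntegral.intervalIntegral_conj,
    ← intervalIntegral.integral_const_mul]
  apply intervalIntegral.integral_congr
  intro θ _
  simp only
  have hzs : circleMap 0 r θ ∈ sphere (0:ℂ) r := circleMap_mem_sphere _ hr.le _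
  have hξ : circleMap 0 r⁻¹ θ = (conj (circleMap 0 r θ))⁻¹ := by
    simp only [circleMap_zero, map_mul, conj_ofReal, ← exp_conj, conj_I, mul_inv, ← exp_neg]
    simp
  rw [deriv_circleMap, deriv_circleMap, hξ]
  generalize circleMap 0 r θ = ζ at *
  have h0 := hz0 ζ hzs
  have h1 := hzw ζ hzs
  simp only [map_mul, map_inv₀, conj_conj, map_sub, inv_inv, conj_I, conj_ofReal, map_ofNat]
  have h2 : ζ⁻¹ - w⁻¹ ≠ 0 := by
    rw [sub_ne_zero]
    intro h
    exact h1 (sub_eq_zero.2 (inv_injective h))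
  have hpi : (Real.pi : ℂ) ≠ 0 := by exact_mod_cast Real.pi_ne_zero
  have h3 : (ζ⁻¹ - w⁻¹)⁻¹ = - (ζ * w) * (ζ - w)⁻¹ := by
    have : ζ⁻¹ - w⁻¹ = - (ζ - w) * (ζ * w)⁻¹ := by
      field_simp
      ring
    rw [this, mul_inv, inv_inv, ← neg_inv]
    ring
  rw [h3]
  field_simp
  ring_nf

open ComplexConjugate in
lemma reflect {r r' : ℝ} (hr : 0 < r) (hrr : r < r') (hr1 : r' < 1) (G : ℂ → ℂ)
    (hG : DifferentiableOn ℂ G {w : ℂ | r < ‖w‖ ∧ ‖w‖ < 1})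
    (hRe : ∀ δ > 0, ∃ ρ < (1:ℝ), ∀ w : ℂ, ρ < ‖w‖ → ‖w‖ < 1 → |(G w).re| ≤ δ) :
    ∃ H : ℂ → ℂ, DifferentiableOn ℂ H {w : ℂ | r' < ‖w‖ ∧ ‖w‖ < r'⁻¹} ∧
      (∀ w : ℂ, r' < ‖w‖ → ‖w‖ < 1 → H w = G w) ∧
      ∀ w : ℂ, H (conj w)⁻¹ = - conj (H w) := by
  have hr'0 : 0 < r' := hr.trans hrr
  have hr'i : 1 < r'⁻¹ := (one_lt_inv₀ hr'0).2 hr1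
  have hGs : ∀ ρ : ℝ, r < ρ → ρ < 1 → ContinuousOn G (sphere 0 ρ) := by
    intro ρ h1 h2
    refine hG.continuousOn.mono ?_
    intro z hz
    have : ‖z‖ = ρ := by simpa using hz
    exact ⟨by linarith, by linarith⟩
  have hF : ContinuousOn (fun z => conj (G (conj z)⁻¹)) (sphere 0 r'⁻¹) := by
    refine Complex.continuous_conj.comp_continuousOn ?_
    refine (hGs r' hrr hr1).comp ?_ ?_
    · refine (Complex.continuous_conj.continuousOn).inv₀ ?_
      intro z hz h
      have h1 : ‖z‖ = r'⁻¹ := by simpa using hz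
      rw [map_eq_zero] at h
      rw [h] at h1
      simp at h1
      linarith
    · intro z hz
      have h1 : ‖z‖ = r'⁻¹ := by simpa using hz
      simp [h1]
  obtain ⟨C, hC⟩ : ∃ C : ℂ → ℂ, C = fun v => (2 * Real.pi * I : ℂ)⁻¹ •
    ∮ z in C(0, r'⁻¹), (z - v)⁻¹ • conj (G (conj z)⁻¹) := ⟨_, rfl⟩
  have hCd : DifferentiableOn ℂ C (ball 0 r'⁻¹) := hC ▸ cauchy_diff (by positivity) _ hF
  obtain ⟨m, hm⟩ : ∃ m : ℂ, m = (2 * Real.pi * I : ℂ)⁻¹ • (∮ z in C(0, r'), z⁻¹ • G z) := ⟨_, rfl⟩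
  have hkey : ∀ w : ℂ, r' < ‖w‖ → conj (C (conj w)⁻¹) = m
      - (2 * Real.pi * I : ℂ)⁻¹ • ∮ z in C(0, r'), (z - w)⁻¹ • G z := by
    intro w hw
    rw [hC, hm]
    exact reflect_key hr'0 G (hGs r' hrr hr1) hw
  -- the difference
  obtain ⟨Q, hQ⟩ : ∃ Q : ℂ → ℂ, Q = fun w => G w - conj (C (conj w)⁻¹) + C w := ⟨_, rfl⟩
  have hQP : ∀ R : ℝ, r' < R → R < 1 → ∃ P : ℂ → ℂ, DifferentiableOn ℂ P (ball 0 R) ∧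
      ∀ w : ℂ, r' < ‖w‖ → ‖w‖ < R → Q w = P w := by
    intro R h1 h2
    refine ⟨fun w => (2 * Real.pi * I : ℂ)⁻¹ • (∮ z in C(0, R), (z - w)⁻¹ • G z) - m + C w, ?_, ?_⟩
    · refine ((cauchy_diff (by linarith) G (hGs R (by linarith) h2)).sub_const m).add
        (hCd.mono (ball_subset_ball (by linarith)))
    · intro w h3 h4
      simp only [hQ]
      rw [hkey w h3, cauchy_ann hr hrr h2 G hG h3 h4]
      ring
  have hCcc : DifferentiableOn ℂ (fun w => conj (C (conj w)⁻¹)) {w : ℂ | r' < ‖w‖} := by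
    intro w hw
    have hw0 : w ≠ 0 := by
      rintro rfl
      simp at hw; linarith
    have h1 : DifferentiableAt ℂ C (conj w⁻¹) := by
      refine hCd.differentiableAt (isOpen_ball.mem_nhds ?_)
      simp only [mem_ball_zero_iff, RCLike.norm_conj, norm_inv]
      exact inv_strictAnti₀ hr'0 hw
    have h2 := h1.conj_conj
    rw [conj_conj] at h2
    have h3 := h2.comp w (differentiableAt_inv hw0)
    have h4 : (fun w => conj (C (conj w)⁻¹)) = (conj ∘ C ∘ conj) ∘ (fun w : ℂ => w⁻¹) := by
      funext x
      simp
    rw [h4]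
    exact h3.differentiableWithinAt
  have hQd : DifferentiableOn ℂ Q {w : ℂ | r' < ‖w‖ ∧ ‖w‖ < 1} := by
    rw [hQ]
    refine ((hG.mono ?_).sub (hCcc.mono ?_)).add (hCd.mono ?_)
    · rintro w ⟨h1, h2⟩; exact ⟨by linarith, h2⟩
    · rintro w ⟨h1, h2⟩; exact h1
    · rintro w ⟨h1, h2⟩; simp only [mem_ball_zero_iff]; linarith
  have hQsmall : ∀ δ > 0, ∃ ρ < (1:ℝ), ∀ w : ℂ, ρ < ‖w‖ → ‖w‖ < 1 → |(Q w).re| ≤ δ := by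
    intro δ hδ
    obtain ⟨ρ1, hρ1, h1⟩ := hRe (δ / 2) (by positivity)
    set B := (1 + r'⁻¹) / 2 with hB
    have huc : UniformContinuousOn C (closedBall 0 B) :=
      (isCompact_closedBall _ _).uniformContinuousOn_of_continuous
        (hCd.continuousOn.mono (closedBall_subset_ball (by linarith)))
    rw [Metric.uniformContinuousOn_iff_le] at huc
    obtain ⟨η, hη, h2⟩ := huc (δ / 2) (by positivity)
    have hcont : ContinuousAt (fun x : ℝ => x⁻¹ - x) 1 := by
      refine (continuousAt_inv₀ one_ne_zero).sub continuousAt_id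
    have hev1 : ∀ᶠ x : ℝ in 𝓝 1, x⁻¹ - x < η := by
      refine hcont.eventually_lt continuousAt_const ?_
      simpa using hη
    have hev2 : ∀ᶠ x : ℝ in 𝓝 1, x⁻¹ < B := by
      refine (continuousAt_inv₀ one_ne_zero).eventually_lt continuousAt_const ?_
      simp only [inv_one]; linarith
    obtain ⟨σ, hσ, h3⟩ := Metric.eventually_nhds_iff.1 (hev1.and hev2)
    refine ⟨max ρ1 (max (1 - σ) r'), by simp [hρ1, hσ, hr1], ?_⟩
    intro w hw hw1
    simp only [max_lt_iff] at hw
    have hw0 : 0 < ‖w‖ := by linarith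
    have h4 := @h3 ‖w‖ (by rw [Real.dist_eq, abs_lt]; constructor <;> linarith)
    have h5 := h1 w hw.1 hw1
    have hwi : 1 < ‖w‖⁻¹ := (one_lt_inv₀ hw0).2 hw1
    have h6 := h2 w (by simp only [mem_closedBall_zero_iff]; linarith) (conj w)⁻¹
      (by simp only [mem_closedBall_zero_iff, norm_inv, RCLike.norm_conj]; linarith) ?_
    · rw [dist_eq_norm] at h6
      have h7 := (Complex.abs_re_le_norm (C w - C (conj w)⁻¹)).trans h6
      have h8 : (Q w).re = (G w).re + (C w - C (conj w)⁻¹).re := by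
        simp only [hQ, add_re, sub_re, conj_re]; ring
      rw [h8]
      calc _ ≤ _ := abs_add_le _ _
        _ ≤ δ / 2 + δ / 2 := add_le_add h5 h7
        _ = δ := by ring
    · have hwne : w ≠ 0 := norm_pos_iff.1 hw0
      have h9 : (conj w)⁻¹ = ((‖w‖⁻¹ ^ 2 : ℝ) : ℂ) * w := by
        have h10 : (conj w) ≠ 0 := by simpa using hwne
        have h11 := Complex.mul_conj' w
        have h12 : (‖w‖ : ℂ) ≠ 0 := by exact_mod_cast hw0.ne'
        push_cast
        field_simp
        linear_combination -h11
      have h10 : w - (conj w)⁻¹ = ((1 - ‖w‖⁻¹ ^ 2 : ℝ) : ℂ) * w := by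
        rw [h9]; push_cast; ring
      rw [dist_eq_norm, h10, norm_mul, Complex.norm_real, Real.norm_eq_abs, abs_of_nonpos]
      · have : -(1 - ‖w‖⁻¹ ^ 2) * ‖w‖ = ‖w‖⁻¹ - ‖w‖ := by field_simp; ring
        rw [this]; exact h4.1.le
      · nlinarith
  have hQ0 : ∀ w : ℂ, r' < ‖w‖ → ‖w‖ < 1 → (Q w).re = 0 := by
    intro w hw hw1
    rw [← abs_eq_zero]
    refine le_antisymm (le_of_forall_pos_le_add fun δ hδ => ?_) (abs_nonneg _)
    rw [zero_add]
    obtain ⟨ρ, hρ, h1⟩ := hQsmall δ hδ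
    set R' := (max ρ ‖w‖ + 1) / 2 with hR'
    have hm1 : max ρ ‖w‖ < 1 := max_lt hρ hw1
    have hm2 := le_max_left ρ ‖w‖
    have hm3 := le_max_right ρ ‖w‖
    have hwR : ‖w‖ < R' := by linarith
    obtain ⟨P, hP, hP'⟩ := hQP ((R' + 1) / 2) (by linarith) (by linarith)
    rw [hP' w hw (by linarith)]
    refine re_max (R := (R' + 1) / 2) (R' := R') (by linarith) (by linarith) P hP ?_ w hwR.le
    intro z hz
    rw [← hP' z (by linarith) (by linarith)]
    exact h1 z (by linarith) (by linarith)
  obtain ⟨κ, hκ, hκ0⟩ : ∃ κ : ℂ, (∀ w : ℂ, r' < ‖w‖ → ‖w‖ < 1 → Q w = κ) ∧ κ.re = 0 := by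
    have hconn := ann_connected hr'0 hr1
    obtain ⟨w0, hw0⟩ := hconn.1
    rcases (hQd.analyticOnNhd (ann_open r' 1)).is_constant_or_isOpen hconn.2 with ⟨κ, h⟩ | h
    · exact ⟨κ, fun w h1 h2 => h w ⟨h1, h2⟩, by rw [← h w0 hw0]; exact hQ0 w0 hw0.1 hw0.2⟩
    · exfalso
      have h1 := h _ subset_rfl (ann_open r' 1)
      rw [Metric.isOpen_iff] at h1
      obtain ⟨η, hη, h2⟩ := h1 (Q w0) ⟨w0, hw0, rfl⟩
      have h3 : Q w0 + (η / 2 : ℝ) ∈ ball (Q w0) η := by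
        rw [mem_ball, dist_eq_norm]
        simp only [add_sub_cancel_left, Complex.norm_real, Real.norm_eq_abs]
        rw [abs_of_pos (by positivity)]; linarith
      obtain ⟨w1, hw1, h4⟩ := h2 h3
      have h5 := congrArg Complex.re h4
      rw [hQ0 w1 hw1.1 hw1.2, add_re, hQ0 w0 hw0.1 hw0.2, ofReal_re] at h5
      linarith
  refine ⟨fun w => conj (C (conj w)⁻¹) - C w + κ, ?_, ?_, ?_⟩
  · refine ((hCcc.mono ?_).sub (hCd.mono ?_)).add_const κ
    · rintro w ⟨h1, h2⟩; exact h1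
    · rintro w ⟨h1, h2⟩; simpa using h2
  · intro w h1 h2
    rw [← hκ w h1 h2, hQ]
    ring
  · intro w
    have : conj κ = -κ := by
      apply Complex.ext <;> simp [hκ0]
    simp only [map_inv₀, conj_conj, inv_inv, map_add, map_sub, this]
    ring

open ComplexConjugate in
lemma refl_deriv {r : ℝ} (hr : 0 < r) (H : ℂ → ℂ) (c : ℂ)
    (hH : DifferentiableOn ℂ H {w : ℂ | r < ‖w‖ ∧ ‖w‖ < r⁻¹})
    (hs : ∀ w : ℂ, r < ‖w‖ → ‖w‖ < r⁻¹ → H (conj w)⁻¹ = c * conj (H w))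
    {w : ℂ} (h1 : r < ‖w‖) (h2 : ‖w‖ < r⁻¹) :
    deriv H (conj w)⁻¹ = - c * (conj w) ^ 2 * conj (deriv H w) := by
  have hw0 : w ≠ 0 := by
    rintro rfl
    simp at h1; linarith
  have hwn : 0 < ‖w‖ := norm_pos_iff.2 hw0
  set ξ := (conj w)⁻¹ with hξ
  have hξ0 : ξ ≠ 0 := by simpa [hξ] using hw0
  have hwξ : w = conj (ξ⁻¹) := by simp [hξ]
  have hξn : ‖ξ‖ = ‖w‖⁻¹ := by simp [hξ]
  have hmem : ξ ∈ {w : ℂ | r < ‖w‖ ∧ ‖w‖ < r⁻¹} := by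
    refine ⟨?_, ?_⟩
    · rw [hξn]; exact (lt_inv_comm₀ hwn hr).1 h2
    · rw [hξn]; exact inv_strictAnti₀ hr h1
  have hd : HasDerivAt H (deriv H w) w :=
    (hH.differentiableAt ((ann_open r r⁻¹).mem_nhds ⟨h1, h2⟩)).hasDerivAt
  rw [hwξ] at hd
  have h3 := hd.conj_conj
  rw [conj_conj] at h3
  have h4 := (h3.comp ξ (hasDerivAt_inv hξ0)).const_mul c
  have h5 : H =ᶠ[𝓝 ξ] fun x => c * ((conj ∘ H ∘ conj) ∘ (fun x : ℂ => x⁻¹)) x := by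
    filter_upwards [(ann_open r r⁻¹).mem_nhds hmem] with x hx
    have hxn : 0 < ‖x‖ := hr.trans hx.1
    have := hs (conj x)⁻¹ (by simpa using (lt_inv_comm₀ hxn hr).1 hx.2)
      (by simpa using inv_strictAnti₀ hr hx.1)
    simpa using this
  rw [h5.deriv_eq, h4.deriv, ← hwξ]
  have : conj w = ξ⁻¹ := by simp [hξ]
  rw [this]
  ring

open ComplexConjugate in
lemma neg_arg {r R : ℝ} (hr : 0 < r) (hrR : r < R) (hR1 : R < 1) (H : ℂ → ℂ) (c : ℂ) (hc : c ≠ 0)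
    (hH : DifferentiableOn ℂ H {w : ℂ | r < ‖w‖ ∧ ‖w‖ < r⁻¹})
    (hs : ∀ w : ℂ, r < ‖w‖ → ‖w‖ < r⁻¹ → H (conj w)⁻¹ = c * conj (H w))
    (hz : ∀ w : ℂ, ‖w‖ = R → H w ≠ 0) :
    (∮ w in C(0, R), logDeriv H w).im ≤ 0 := by
  have hR : 0 < R := hr.trans hrR
  have hRi : 1 < R⁻¹ := (one_lt_inv₀ hR).2 hR1
  have hri : R⁻¹ < r⁻¹ := inv_strictAnti₀ hr hrR
  have hz2 : ∀ w : ℂ, ‖w‖ = R⁻¹ → H w ≠ 0 := by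
    intro w hw
    have h1 : ‖(conj w)⁻¹‖ = R := by simp [hw]
    have h2 := hs (conj w)⁻¹ (by linarith) (by linarith)
    have h3 : (conj (conj w)⁻¹)⁻¹ = w := by simp
    rw [h3] at h2
    rw [h2]
    exact mul_ne_zero hc (by simpa using hz _ h1)
  have h1 := argmono hr hrR (by linarith : R ≤ R⁻¹) hri H hH hz hz2
  have h2 : (∮ w in C(0, R⁻¹), logDeriv H w) = conj (∮ w in C(0, R), logDeriv H w) := by
    simp only [circleIntegral]
    rw [← intervalIntegral.intervalIntegral_conj]
    apply intervalIntegral.integral_congr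
    intro θ _
    simp only [smul_eq_mul]
    have hn : ‖circleMap 0 R θ‖ = R := by simp [abs_of_pos hR]
    have hξ : circleMap 0 R⁻¹ θ = (conj (circleMap 0 R θ))⁻¹ := by
      simp only [circleMap_zero, map_mul, conj_ofReal, ← exp_conj, conj_I, mul_inv, ← exp_neg]
      simp
    rw [deriv_circleMap, deriv_circleMap, hξ]
    generalize circleMap 0 R θ = w at *
    rw [logDeriv_apply, logDeriv_apply, refl_deriv hr H c hH hs (by linarith) (by linarith),
      hs w (by linarith) (by linarith)]
    have hw0 : conj w ≠ 0 := by
      intro h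
      rw [map_eq_zero] at h
      rw [h] at hn; simp at hn; linarith
    have h3 : conj (H w) ≠ 0 := by simpa using hz w hn
    simp only [map_mul, map_div₀, conj_I]
    field_simp
  rw [h2, conj_im] at h1
  linarith

lemma qparam_der {ℓ : ℝ} (hℓ : 0 < ℓ) : ∀ z : ℂ, HasDerivAt (Function.Periodic.qParam (2 * ℓ))
      (Function.Periodic.qParam (2 * ℓ) z * (Real.pi * I / ℓ)) z := by
  have hℓc : (ℓ : ℂ) ≠ 0 := by exact_mod_cast hℓ.ne'
  intro z
  have h1 := (((hasDerivAt_id z).const_mul (2 * Real.pi * I)).div_const ((2 * ℓ : ℝ) : ℂ)).cexp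
  refine HasDerivAt.congr_deriv h1 ?_
  simp only [Function.Periodic.qParam, id, mul_one]
  congr 1
  push_cast
  field_simp

lemma transit {ℓ : ℝ} (hℓ : 0 < ℓ) (h H : ℂ → ℂ) (y : ℝ)
    (hHd : ∀ t : ℝ, DifferentiableAt ℂ H (Function.Periodic.qParam (2 * ℓ) (t + y * I)))
    (hhH : ∀ t : ℝ, h =ᶠ[𝓝 ((t : ℂ) + y * I)] H ∘ Function.Periodic.qParam (2 * ℓ)) :
    (∮ w in C(0, Real.exp (-Real.pi * y / ℓ)), logDeriv H w) =
      ∫ t in (0:ℝ)..(2 * ℓ), logDeriv h (t + y * I) := by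
  have hℓc : (ℓ : ℂ) ≠ 0 := by exact_mod_cast hℓ.ne'
  have hq : ∀ t : ℝ, circleMap 0 (Real.exp (-Real.pi * y / ℓ)) (Real.pi / ℓ * t) =
      Function.Periodic.qParam (2 * ℓ) (t + y * I) := by
    intro t
    rw [circleMap_zero, Function.Periodic.qParam, ofReal_exp, ← Complex.exp_add]
    congr 1
    push_cast
    field_simp
    ring_nf
    simp
  have hqd := qparam_der hℓ
  have hpt : ∀ t : ℝ, logDeriv h (t + y * I) =
      (Real.pi / ℓ : ℝ) • (deriv (circleMap 0 (Real.exp (-Real.pi * y / ℓ))) (Real.pi / ℓ * t) •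
      logDeriv H (circleMap 0 (Real.exp (-Real.pi * y / ℓ)) (Real.pi / ℓ * t))) := by
    intro t
    rw [deriv_circleMap, hq]
    have h1 : logDeriv h (t + y * I) =
        logDeriv (H ∘ Function.Periodic.qParam (2 * ℓ)) (t + y * I) := by
      rw [logDeriv_apply, logDeriv_apply, (hhH t).deriv_eq, (hhH t).self_of_nhds]
    rw [h1, logDeriv_comp (hHd t) (hqd _).differentiableAt, (hqd _).deriv, real_smul, smul_eq_mul]
    push_cast
    ring
  rw [circleIntegral]
  simp_rw [hpt]
  rw [intervalIntegral.integral_smul, intervalIntegral.smul_integral_comp_mul_left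
    (fun θ => deriv (circleMap 0 (Real.exp (-Real.pi * y / ℓ))) θ •
      logDeriv H (circleMap 0 (Real.exp (-Real.pi * y / ℓ)) θ))]
  congr 1
  · simp
  · field_simp

lemma exp_int {ℓ : ℝ} (h : ℂ → ℂ) (y : ℝ)
    (han : ∀ t : ℝ, AnalyticAt ℂ h (t + y * I)) (hne : ∀ t : ℝ, h (t + y * I) ≠ 0) :
    exp (∫ t in (0:ℝ)..ℓ, logDeriv h (t + y * I)) * h (y * I) = h (ℓ + y * I) := by
  have hLc : Continuous fun t : ℝ => logDeriv h (t + y * I) := by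
    rw [continuous_iff_continuousAt]
    intro t
    have h1 : ContinuousAt (logDeriv h) ((t:ℂ) + y * I) :=
      ((han t).deriv.div (han t) (hne t)).continuousAt
    exact ContinuousAt.comp (f := fun t : ℝ => (t : ℂ) + y * I) h1 (by fun_prop)
  have hder : ∀ t : ℝ, HasDerivAt (fun t : ℝ => h (t + y * I) *
      exp (- ∫ s in (0:ℝ)..t, logDeriv h (s + y * I))) 0 t := by
    intro t
    have h1 : HasDerivAt (fun t : ℝ => ∫ s in (0:ℝ)..t, logDeriv h (s + y * I))
        (logDeriv h (t + y * I)) t :=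
      intervalIntegral.integral_hasDerivAt_right (hLc.intervalIntegrable _ _)
        (hLc.stronglyMeasurableAtFilter _ _) hLc.continuousAt
    have h2 : HasDerivAt (fun t : ℝ => h (t + y * I)) (deriv h (t + y * I)) t := by
      have h3 : HasDerivAt (fun t : ℝ => (t : ℂ) + y * I) 1 t :=
        (Complex.ofRealCLM.hasDerivAt (x := t)).add_const _
      have h4 := HasDerivAt.comp (h₂ := h) t (han t).differentiableAt.hasDerivAt h3
      rw [mul_one] at h4
      exact h4
    refine HasDerivAt.congr_deriv (h2.mul h1.neg.cexp) ?_
    simp only [Pi.neg_apply]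
    rw [logDeriv_apply]
    field_simp [hne t]
    ring
  have hconst := is_const_of_deriv_eq_zero (fun t => (hder t).differentiableAt)
    (fun t => (hder t).deriv) ℓ 0
  simp only [intervalIntegral.integral_same, neg_zero, Complex.exp_zero, mul_one, ofReal_zero,
    zero_add] at hconst
  rw [← hconst, Complex.exp_neg]
  field_simp

open ComplexConjugate in
lemma mainneg {ℓ : ℝ} (hℓ : 0 < ℓ) (h H : ℂ → ℂ) (y r : ℝ) (hy : 0 < y) (c : ℂ) (hc : c ≠ 0)
    (hanti : Function.Antiperiodic h (ℓ : ℂ))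
    (han : ∀ t : ℝ, AnalyticAt ℂ h (t + y * I)) (hne : ∀ t : ℝ, h (t + y * I) ≠ 0)
    (hr : 0 < r) (hrR : r < Real.exp (-Real.pi * y / ℓ))
    (hH : DifferentiableOn ℂ H {w : ℂ | r < ‖w‖ ∧ ‖w‖ < r⁻¹})
    (hs : ∀ w : ℂ, r < ‖w‖ → ‖w‖ < r⁻¹ → H (conj w)⁻¹ = c * conj (H w))
    (hhH : ∀ t : ℝ, h =ᶠ[𝓝 ((t : ℂ) + y * I)] H ∘ Function.Periodic.qParam (2 * ℓ)) :
    (∫ t in (0:ℝ)..ℓ, logDeriv h (t + y * I)).im < 0 := by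
  have hR1 : Real.exp (-Real.pi * y / ℓ) < 1 := by
    rw [Real.exp_lt_one_iff]
    have : 0 < Real.pi * y / ℓ := by positivity
    rw [neg_mul, neg_div]; linarith
  have hqn : ∀ t : ℝ, ‖Function.Periodic.qParam (2 * ℓ) ((t:ℂ) + y * I)‖ =
      Real.exp (-Real.pi * y / ℓ) := by
    intro t
    rw [Function.Periodic.norm_qParam]
    congr 1
    simp
    field_simp
  have hri : 1 < r⁻¹ := (one_lt_inv₀ hr).2 (by linarith)
  have hT := transit hℓ h H y (fun t => hH.differentiableAt ((ann_open r r⁻¹).mem_nhds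
    ⟨by rw [hqn]; exact hrR, by rw [hqn]; linarith⟩)) hhH
  have hzH : ∀ w : ℂ, ‖w‖ = Real.exp (-Real.pi * y / ℓ) → H w ≠ 0 := by
    intro w hw
    have hw0 : w ≠ 0 := by
      rintro rfl
      simp at hw
      exact (Real.exp_pos _).ne hw
    have h1 := Function.Periodic.qParam_right_inv (h := 2 * ℓ) (by positivity) hw0
    have him : (Function.Periodic.invQParam (2 * ℓ) w).im = y := by
      rw [Function.Periodic.im_invQParam, hw, Real.log_exp]
      field_simp
    have h2 : Function.Periodic.invQParam (2 * ℓ) w =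
        (((Function.Periodic.invQParam (2 * ℓ) w).re : ℝ) : ℂ) + y * I := by
      rw [← him, Complex.re_add_im]
    have h3 := (hhH (Function.Periodic.invQParam (2 * ℓ) w).re).self_of_nhds
    have h4 := hne (Function.Periodic.invQParam (2 * ℓ) w).re
    rw [h3, Function.comp_apply, ← h2, h1] at h4
    exact h4
  have hle := neg_arg hr hrR hR1 H c hc hH hs hzH
  rw [hT] at hle
  set L : ℝ → ℂ := fun t => logDeriv h (t + y * I) with hL
  have hLc : Continuous L := by
    rw [continuous_iff_continuousAt]
    intro t
    have h1 : ContinuousAt (logDeriv h) ((t:ℂ) + y * I) :=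
      ((han t).deriv.div (han t) (hne t)).continuousAt
    exact ContinuousAt.comp (f := fun t : ℝ => (t : ℂ) + y * I) h1 (by fun_prop)
  have hLp : Function.Periodic L ℓ := by
    intro t
    have h1 : deriv h ((t:ℂ) + y * I + ℓ) = - deriv h (t + y * I) := by
      rw [← deriv_comp_add_const, ← deriv.fun_neg]
      congr 1
      funext z
      exact hanti z
    have h2 : ((t + ℓ : ℝ) : ℂ) + y * I = t + y * I + ℓ := by push_cast; ring
    simp only [hL, h2, logDeriv_apply, h1, hanti (t + y * I), neg_div_neg_eq]
  have h2ℓ : (∫ t in (0:ℝ)..(2 * ℓ), L t) = 2 * ∫ t in (0:ℝ)..ℓ, L t := by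
    rw [← intervalIntegral.integral_add_adjacent_intervals (b := ℓ) (hLc.intervalIntegrable _ _)
      (hLc.intervalIntegrable _ _)]
    have := hLp.intervalIntegral_add_eq ℓ 0
    rw [zero_add, ← two_mul] at this
    rw [this]; ring
  have hle' : (∫ t in (0:ℝ)..ℓ, L t).im ≤ 0 := by
    have : (∫ t in (0:ℝ)..(2 * ℓ), L t).im ≤ 0 := hle
    rw [h2ℓ] at this
    simp at this
    linarith
  refine lt_of_le_of_ne hle' ?_
  intro h0
  have he := exp_int (ℓ := ℓ) h y han hne
  have h1 : h (ℓ + y * I) = - h (y * I) := by rw [add_comm]; exact hanti _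
  rw [h1] at he
  have hy0 : h (y * I) ≠ 0 := by simpa using hne 0
  have he2 : exp (∫ t in (0:ℝ)..ℓ, L t) = -1 := by
    have : (exp (∫ t in (0:ℝ)..ℓ, L t) + 1) * h (y * I) = 0 := by
      rw [add_mul, one_mul, he]; ring
    rcases mul_eq_zero.1 this with h2 | h2
    · exact eq_neg_of_add_eq_zero_left h2
    · exact absurd h2 hy0
  have h3 := congrArg Complex.re he2
  rw [Complex.exp_re, h0, Real.cos_zero, mul_one] at h3
  simp at h3
  have := Real.exp_pos (∫ t in (0:ℝ)..ℓ, L t).re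
  linarith

lemma invq_re {ℓ : ℝ} (w : ℂ) :
    (Function.Periodic.invQParam (2 * ℓ) w).re = ℓ / Real.pi * arg w := by
  have hpi : (Real.pi : ℂ) ≠ 0 := by exact_mod_cast Real.pi_ne_zero
  have : Function.Periodic.invQParam (2 * ℓ) w = ((ℓ / Real.pi : ℝ) : ℂ) * (-I * Complex.log w) := by
    rw [Function.Periodic.invQParam]
    push_cast
    field_simp
    rw [show (I : ℂ) ^ 2 = -1 from I_sq]
    ring
  rw [this, re_ofReal_mul]
  simp [Complex.log_im]

open ComplexConjugate in
lemma strip_ext {ℓ ε y : ℝ} (hℓ : 0 < ℓ) (hy : 0 < y) (hyε : y < ε) (h : ℂ → ℂ)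
    (hanti : Function.Antiperiodic h (ℓ : ℂ))
    (hd : DifferentiableOn ℂ h {z : ℂ | 0 < z.im ∧ z.im < ε}) (u : ℂ → ℝ)
    (huc : ContinuousOn u ({z : ℂ | 0 < z.im ∧ z.im < ε} ∪ {z : ℂ | z.im = 0}))
    (hu : ∀ z : ℂ, 0 < z.im → z.im < ε → u z = (h z).re)
    (hu0 : ∀ z : ℂ, z.im = 0 → u z = 0) :
    ∃ r : ℝ, ∃ H : ℂ → ℂ, 0 < r ∧ r < Real.exp (-Real.pi * y / ℓ) ∧
      DifferentiableOn ℂ H {w : ℂ | r < ‖w‖ ∧ ‖w‖ < r⁻¹} ∧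
      (∀ w : ℂ, H (conj w)⁻¹ = - conj (H w)) ∧
      ∀ z : ℂ, 0 < z.im → z.im < (y + ε) / 2 → h z = H (Function.Periodic.qParam (2 * ℓ) z) := by
  have hpi := Real.pi_pos
  have hε : 0 < ε := hy.trans hyε
  have h2ℓ : 2 * ℓ ≠ 0 := by positivity
  have hper : Function.Periodic h ((2 * ℓ : ℝ) : ℂ) := by
    have := hanti.periodic_two_mul
    push_cast
    exact this
  have hopen : IsOpen {z : ℂ | 0 < z.im ∧ z.im < ε} :=
    (isOpen_lt continuous_const continuous_im).inter (isOpen_lt continuous_im continuous_const)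
  have hmono : ∀ a b : ℝ, a < b → Real.exp (-Real.pi * b / ℓ) < Real.exp (-Real.pi * a / ℓ) := by
    intro a b hab
    apply Real.exp_lt_exp.2
    gcongr ?_ / ℓ
    nlinarith
  -- the imaginary part of invQParam
  have him : ∀ w : ℂ, (Function.Periodic.invQParam (2 * ℓ) w).im =
      - (ℓ / Real.pi * Real.log ‖w‖) := by
    intro w
    rw [Function.Periodic.im_invQParam]
    field_simp
  have hlow : ∀ (a : ℝ) (w : ℂ), Real.exp (-Real.pi * a / ℓ) < ‖w‖ →
      (Function.Periodic.invQParam (2 * ℓ) w).im < a := by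
    intro a w hw
    have h0 : 0 < ‖w‖ := (Real.exp_pos _).trans hw
    have h1 := (Real.lt_log_iff_exp_lt h0).2 hw
    rw [him]
    have h2 : ℓ / Real.pi * (-Real.pi * a / ℓ) < ℓ / Real.pi * Real.log ‖w‖ := by gcongr
    have h3 : ℓ / Real.pi * (-Real.pi * a / ℓ) = -a := by field_simp
    linarith
  have hpos : ∀ w : ℂ, 0 < ‖w‖ → ‖w‖ < 1 → 0 < (Function.Periodic.invQParam (2 * ℓ) w).im := by
    intro w h0 h1
    rw [him]
    have h2 := Real.log_neg h0 h1
    have h3 : 0 < ℓ / Real.pi := by positivity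
    nlinarith
  set G := Function.Periodic.cuspFunction (2 * ℓ) h with hGdef
  have hGe : ∀ w : ℂ, w ≠ 0 → G w = h (Function.Periodic.invQParam (2 * ℓ) w) := fun w hw =>
    Function.Periodic.cuspFunction_eq_of_nonzero _ _ hw
  have hGd : DifferentiableOn ℂ G {w | Real.exp (-Real.pi * ε / ℓ) < ‖w‖ ∧ ‖w‖ < 1} := by
    intro w hw
    have h0 : 0 < ‖w‖ := (Real.exp_pos _).trans hw.1
    have hw0 : w ≠ 0 := norm_pos_iff.1 h0
    have h1 := Function.Periodic.differentiableAt_cuspFunction h2ℓ hper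
      (hd.differentiableAt (hopen.mem_nhds ⟨hpos w h0 hw.2, hlow ε w hw.1⟩))
    rw [Function.Periodic.qParam_right_inv h2ℓ hw0] at h1
    exact h1.differentiableWithinAt
  have hGRe : ∀ δ > 0, ∃ ρ < (1:ℝ), ∀ w, ρ < ‖w‖ → ‖w‖ < 1 → |(G w).re| ≤ δ := by
    intro δ hδ
    have hKc : IsCompact (Icc (-ℓ) ℓ ×ℂ Icc 0 (ε / 2)) := isCompact_Icc.reProdIm isCompact_Icc
    have hKu : ContinuousOn u (Icc (-ℓ) ℓ ×ℂ Icc 0 (ε / 2)) := by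
      refine huc.mono ?_
      intro z hz
      rw [mem_reProdIm] at hz
      rcases hz.2.1.eq_or_lt with h1 | h1
      · right; exact h1.symm
      · left; exact ⟨h1, by have := hz.2.2; linarith⟩
    have hU := hKc.uniformContinuousOn_of_continuous hKu
    obtain ⟨d, hd0, hdu⟩ := Metric.uniformContinuousOn_iff.1 hU δ hδ
    have hm : 0 < min d (ε / 2) := lt_min hd0 (by positivity)
    refine ⟨Real.exp (-Real.pi * min d (ε / 2) / ℓ), ?_, ?_⟩
    · have := hmono 0 _ hm
      simpa using this
    · intro w hw hw1
      have h0 : 0 < ‖w‖ := (Real.exp_pos _).trans hw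
      have hw0 : w ≠ 0 := norm_pos_iff.1 h0
      rw [hGe w hw0]
      set z := Function.Periodic.invQParam (2 * ℓ) w with hz
      have hz1 : 0 < z.im := hpos w h0 hw1
      have hz2 := hlow _ w hw
      rw [← hz] at hz2
      have hz3 : z.im < d := hz2.trans_le (min_le_left _ _)
      have hz4 : z.im < ε / 2 := hz2.trans_le (min_le_right _ _)
      have hzre : z.re = ℓ / Real.pi * arg w := invq_re w
      have hzr : z.re ∈ Icc (-ℓ) ℓ := by
        have h1 := neg_pi_lt_arg w
        have h2 := arg_le_pi w
        have h3 : 0 < ℓ / Real.pi := by positivity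
        have h4 : ℓ / Real.pi * Real.pi = ℓ := by field_simp
        rw [hzre]
        constructor <;> nlinarith
      have hmz : z ∈ Icc (-ℓ) ℓ ×ℂ Icc 0 (ε / 2) := by
        rw [mem_reProdIm]; exact ⟨hzr, hz1.le, hz4.le⟩
      have hmz' : (z.re : ℂ) ∈ Icc (-ℓ) ℓ ×ℂ Icc 0 (ε / 2) := by
        rw [mem_reProdIm]; exact ⟨by simpa using hzr, by simp; positivity⟩
      have h5 := hdu z hmz (z.re : ℂ) hmz' (by
        rw [Complex.dist_of_re_eq (by simp)]
        simp [abs_of_pos hz1, Real.dist_eq, hz3])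
      rw [hu0 _ (ofReal_im _), Real.dist_eq, sub_zero, hu z hz1 (by linarith)] at h5
      exact h5.le
  obtain ⟨H, hH1, hH2, hH3⟩ := reflect (Real.exp_pos (-Real.pi * ε / ℓ))
    (hmono ((y + ε) / 2) ε (by linarith))
    (by simpa using hmono 0 ((y + ε) / 2) (by linarith)) G hGd hGRe
  refine ⟨Real.exp (-Real.pi * ((y + ε) / 2) / ℓ), H, Real.exp_pos _, hmono _ _ (by linarith),
    hH1, hH3, ?_⟩
  intro z hz0 hz1
  have hn : ‖Function.Periodic.qParam (2 * ℓ) z‖ = Real.exp (-Real.pi * z.im / ℓ) := by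
    rw [Function.Periodic.norm_qParam]
    congr 1
    field_simp
  rw [hH2 _ (by rw [hn]; exact hmono _ _ hz1) (by rw [hn]; simpa using hmono 0 _ hz0),
    hGdef, Function.Periodic.eq_cuspFunction h2ℓ hper]

lemma level_strip (y a : ℝ) (hy : 0 < y) (hya : y < a) (t : ℝ) :
    ∀ᶠ z in 𝓝 ((t : ℂ) + y * I), 0 < z.im ∧ z.im < a := by
  have hopen : IsOpen {z : ℂ | 0 < z.im ∧ z.im < a} :=
    (isOpen_lt continuous_const continuous_im).inter (isOpen_lt continuous_im continuous_const)
  exact hopen.mem_nhds (by constructor <;> simp [hy, hya])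

lemma strip_neg1 {ℓ ε y : ℝ} (hℓ : 0 < ℓ) (hy : 0 < y) (hyε : y < ε) (h : ℂ → ℂ)
    (hanti : Function.Antiperiodic h (ℓ : ℂ))
    (hd : DifferentiableOn ℂ h {z : ℂ | 0 < z.im ∧ z.im < ε}) (u : ℂ → ℝ)
    (huc : ContinuousOn u ({z : ℂ | 0 < z.im ∧ z.im < ε} ∪ {z : ℂ | z.im = 0}))
    (hu : ∀ z : ℂ, 0 < z.im → z.im < ε → u z = (h z).re)
    (hu0 : ∀ z : ℂ, z.im = 0 → u z = 0)
    (hne : ∀ t : ℝ, h (t + y * I) ≠ 0) :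
    (∫ t in (0:ℝ)..ℓ, logDeriv h (t + y * I)).im < 0 := by
  obtain ⟨r, H, hr, hrR, hH, hs, hhH⟩ := strip_ext hℓ hy hyε h hanti hd u huc hu hu0
  have han : ∀ t : ℝ, AnalyticAt ℂ h (t + y * I) := fun t =>
    hd.analyticAt (level_strip y ε hy hyε t)
  refine mainneg hℓ h H y r hy (-1) (by norm_num) hanti han hne hr hrR hH
    (fun w _ _ => by rw [hs]; ring) ?_
  intro t
  filter_upwards [level_strip y ((y + ε) / 2) hy (by linarith) t] with z hz
  exact hhH z hz.1 hz.2

open ComplexConjugate in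
lemma strip_neg2 {ℓ ε y : ℝ} (hℓ : 0 < ℓ) (hy : 0 < y) (hyε : y < ε) (h : ℂ → ℂ)
    (hanti : Function.Antiperiodic h (ℓ : ℂ))
    (hd : DifferentiableOn ℂ h {z : ℂ | 0 < z.im ∧ z.im < ε}) (u : ℂ → ℝ)
    (huc : ContinuousOn u ({z : ℂ | 0 < z.im ∧ z.im < ε} ∪ {z : ℂ | z.im = 0}))
    (hu : ∀ z : ℂ, 0 < z.im → z.im < ε → u z = (h z).re)
    (hu0 : ∀ z : ℂ, z.im = 0 → u z = 0)
    (hne : ∀ t : ℝ, deriv h (t + y * I) ≠ 0) :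
    (∫ t in (0:ℝ)..ℓ, logDeriv (deriv h) (t + y * I)).im < 0 := by
  obtain ⟨r, H, hr, hrR, hH, hs, hhH⟩ := strip_ext hℓ hy hyε h hanti hd u huc hu hu0
  have han : ∀ t : ℝ, AnalyticAt ℂ h (t + y * I) := fun t =>
    hd.analyticAt (level_strip y ε hy hyε t)
  have hanti' : Function.Antiperiodic (deriv h) (ℓ : ℂ) := by
    intro z
    rw [← deriv_comp_add_const, ← deriv.fun_neg]
    congr 1
    funext z
    exact hanti z
  have hpt : ∀ t : ℝ, h =ᶠ[𝓝 ((t : ℂ) + y * I)] H ∘ Function.Periodic.qParam (2 * ℓ) := by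
    intro t
    filter_upwards [level_strip y ((y + ε) / 2) hy (by linarith) t] with z hz
    exact hhH z hz.1 hz.2
  have hqn : ∀ t : ℝ, ‖Function.Periodic.qParam (2 * ℓ) ((t:ℂ) + y * I)‖ =
      Real.exp (-Real.pi * y / ℓ) := by
    intro t
    rw [Function.Periodic.norm_qParam]
    congr 1
    simp
    field_simp
  have hR1 : Real.exp (-Real.pi * y / ℓ) < 1 := by
    rw [Real.exp_lt_one_iff]
    have : 0 < Real.pi * y / ℓ := by positivity
    rw [neg_mul, neg_div]; linarith
  have hri : 1 < r⁻¹ := (one_lt_inv₀ hr).2 (by linarith)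
  have hopen := ann_open r r⁻¹
  refine mainneg hℓ (deriv h) (fun w => (Real.pi * I / ℓ) * (w * deriv H w)) y r hy (-1)
    (by norm_num) hanti' (fun t => (han t).deriv) hne hr hrR
    ((differentiableOn_id.mul (hH.deriv hopen)).const_mul _) ?_ ?_
  · intro w h1 h2
    have hw0 : conj w ≠ 0 := by
      intro h
      rw [map_eq_zero] at h
      rw [h] at h1; simp at h1; linarith
    rw [refl_deriv hr H (-1) hH (fun w _ _ => by rw [hs]; ring) h1 h2]
    simp only [map_mul, map_div₀, conj_I, conj_ofReal]
    field_simp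
  · intro t
    have hc : ContinuousAt (Function.Periodic.qParam (2 * ℓ)) ((t:ℂ) + y * I) :=
      (qparam_der hℓ _).continuousAt
    have hev : ∀ᶠ z in 𝓝 ((t:ℂ) + y * I), Function.Periodic.qParam (2 * ℓ) z ∈
        {w : ℂ | r < ‖w‖ ∧ ‖w‖ < r⁻¹} :=
      hc.eventually (hopen.mem_nhds ⟨by rw [hqn]; exact hrR, by rw [hqn]; linarith⟩)
    filter_upwards [(hpt t).eventuallyEq_nhds, hev] with z hz hz2
    rw [hz.deriv_eq]
    have h1 := (HasDerivAt.comp z (hH.differentiableAt (hopen.mem_nhds hz2)).hasDerivAt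
      (qparam_der hℓ z)).deriv
    rw [h1]
    simp only [Function.comp_apply]
    ring

lemma level_shift {ℓ a y₁ y₂ : ℝ} (F : ℂ → ℂ)
    (hF : DifferentiableOn ℂ F {z : ℂ | 0 < z.im ∧ z.im < a})
    (hper : ∀ z : ℂ, 0 < z.im → z.im < a → F (z + ℓ) = F z)
    (h1 : y₁ ∈ Ioo 0 a) (h2 : y₂ ∈ Ioo 0 a) :
    (∫ t in (0:ℝ)..ℓ, F (t + y₁ * I)) = ∫ t in (0:ℝ)..ℓ, F (t + y₂ * I) := by
  have hsub : ∀ s ∈ uIcc y₁ y₂, 0 < s ∧ s < a := by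
    intro s hs
    have := (ordConnected_Ioo (a := (0:ℝ)) (b := a)).uIcc_subset h1 h2 hs
    exact this
  have h := Complex.integral_boundary_rect_eq_zero_of_differentiableOn F (y₁ * I) (ℓ + y₂ * I)
    (hF.mono (by
      intro z hz
      rw [mem_reProdIm] at hz
      simp only [mul_im, add_im, ofReal_im, ofReal_re, I_re, I_im, mul_zero, mul_one, zero_add,
        zero_mul, add_zero] at hz
      exact hsub _ hz.2))
  simp only [mul_im, add_im, ofReal_im, ofReal_re, I_re, I_im, mul_zero, mul_one, zero_add,
        zero_mul, add_zero, mul_re, add_re, sub_zero, ofReal_zero, sub_self] at h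
  have h3 : (∫ s in y₁..y₂, F (ℓ + s * I)) = ∫ s in y₁..y₂, F (s * I) := by
    apply intervalIntegral.integral_congr
    intro s hs
    have := hsub s hs
    simp only
    rw [add_comm, hper] <;> simp [this]
  rw [h3] at h
  rw [add_sub_cancel_right] at h
  exact sub_eq_zero.1 h

lemma zeros_countable (f : ℂ → ℂ) (U : Set ℂ) (hU : IsOpen U) (hc : IsPreconnected U)
    (hf : DifferentiableOn ℂ f U) (hnz : ¬ ∀ z ∈ U, f z = 0) :
    {z | z ∈ U ∧ f z = 0}.Countable := by
  have hfa : AnalyticOnNhd ℂ f U := hf.analyticOnNhd hU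
  have h1 : ∀ x ∈ {z | z ∈ U ∧ f z = 0}, ({x} : Set ℂ) ∈ 𝓝[{z | z ∈ U ∧ f z = 0}] x := by
    intro x hx
    rcases (hfa x hx.1).eventually_eq_zero_or_eventually_ne_zero with h | h
    · exact absurd (fun z hz => hfa.eqOn_zero_of_preconnected_of_eventuallyEq_zero hc hx.1 h hz) hnz
    · rw [eventually_nhdsWithin_iff] at h
      rw [mem_nhdsWithin_iff_eventually]
      filter_upwards [h] with y hy hyZ
      by_contra hne
      exact hy hne hyZ.2
  obtain ⟨t, hts, htc, hsub⟩ := TopologicalSpace.countable_cover_nhdsWithin h1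
  refine htc.mono (hsub.trans ?_)
  simp

lemma logDeriv_per (f : ℂ → ℂ) (ℓ : ℂ) (hf : Function.Antiperiodic f ℓ) :
    Function.Periodic (logDeriv f) ℓ := by
  intro z
  have h1 : deriv f (z + ℓ) = - deriv f z := by
    rw [← deriv_comp_add_const, ← deriv.fun_neg]
    congr 1
    funext z
    exact hf z
  simp only [logDeriv_apply, h1, hf z, neg_div_neg_eq]

lemma logDeriv_per' (f : ℂ → ℂ) (ℓ : ℂ) (hf : Function.Periodic f ℓ) :
    Function.Periodic (logDeriv f) ℓ := by
  intro z
  have h1 : deriv f (z + ℓ) = deriv f z := by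
    rw [← deriv_comp_add_const]
    congr 1
    funext z
    exact hf z
  simp only [logDeriv_apply, h1, hf z]

lemma level_cont (F : ℂ → ℂ) (y : ℝ) (hF : ∀ t : ℝ, AnalyticAt ℂ F (t + y * I))
    (hne : ∀ t : ℝ, F (t + y * I) ≠ 0) : Continuous fun t : ℝ => logDeriv F (t + y * I) := by
  rw [continuous_iff_continuousAt]
  intro t
  have h1 : ContinuousAt (logDeriv F) ((t:ℂ) + y * I) :=
    ((hF t).deriv.div (hF t) (hne t)).continuousAt
  exact ContinuousAt.comp (f := fun t : ℝ => (t : ℂ) + y * I) h1 (by fun_prop)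

lemma core (ℓ : ℝ) (hℓ : 0 < ℓ) (ψ f g : ℂ → ℂ) (ε y₀ : ℝ) (u v : ℂ → ℝ)
    (hε0 : 0 < ε) (hεπ : ε < Real.pi) (hy₀ : y₀ ∈ Ioo 0 Real.pi)
    (hψd : DifferentiableOn ℂ ψ {z : ℂ | 0 < z.im ∧ z.im < Real.pi})
    (hψ0 : ∀ z : ℂ, 0 < z.im → z.im < Real.pi → ψ z ≠ 0)
    (hψper : Function.Periodic ψ (ℓ : ℂ))
    (hwind : (∫ t in (0:ℝ)..ℓ, logDeriv ψ (t + y₀ * I)) = 0)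
    (hfd : DifferentiableOn ℂ f {z : ℂ | 0 < z.im ∧ z.im < Real.pi})
    (hfper : Function.Antiperiodic f (ℓ : ℂ))
    (huc : ContinuousOn u ({z : ℂ | 0 < z.im ∧ z.im < Real.pi} ∪ {z : ℂ | z.im = 0}))
    (hu : ∀ z : ℂ, 0 < z.im → z.im < Real.pi → u z = (f z).re)
    (hu0 : ∀ z : ℂ, z.im = 0 → u z = 0)
    (hgd : ∀ z : ℂ, Real.pi - ε < z.im → z.im < Real.pi → HasDerivAt g (f z * ψ z) z)
    (hgper : Function.Antiperiodic g (ℓ : ℂ))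
    (hvc : ContinuousOn v ({z : ℂ | Real.pi - ε < z.im ∧ z.im < Real.pi} ∪
      {z : ℂ | z.im = Real.pi}))
    (hv : ∀ z : ℂ, Real.pi - ε < z.im → z.im < Real.pi → v z = (g z).im)
    (hv0 : ∀ z : ℂ, z.im = Real.pi → v z = 0) :
    ∀ z ∈ {z : ℂ | 0 < z.im ∧ z.im < Real.pi}, f z = 0 := by
  by_contra hnz
  have hopen : IsOpen {z : ℂ | 0 < z.im ∧ z.im < Real.pi} :=
    (isOpen_lt continuous_const continuous_im).inter (isOpen_lt continuous_im continuous_const)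
  have hconn : IsPreconnected {z : ℂ | 0 < z.im ∧ z.im < Real.pi} :=
    ((convex_halfSpace_im_gt 0).inter (convex_halfSpace_im_lt Real.pi)).isPreconnected
  have hZ := ((zeros_countable f _ hopen hconn hfd hnz).image Complex.im).dense_compl ℝ
  obtain ⟨b, hb, hb1, hb2⟩ := hZ.exists_between (show Real.pi - ε < Real.pi by linarith)
  have hb0 : 0 < b := by linarith
  have hbim : ∀ t : ℝ, ((t : ℂ) + b * I).im = b := by intro t; simp
  have hmem : ∀ t : ℝ, (t : ℂ) + b * I ∈ {z : ℂ | 0 < z.im ∧ z.im < Real.pi} := by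
    intro t; constructor <;> rw [hbim] <;> assumption
  have hfne : ∀ t : ℝ, f (t + b * I) ≠ 0 := by
    intro t h
    exact hb ⟨t + b * I, ⟨hmem t, h⟩, hbim t⟩
  have hψne : ∀ t : ℝ, ψ (t + b * I) ≠ 0 := fun t => hψ0 _ (hmem t).1 (hmem t).2
  have hfan : ∀ t : ℝ, AnalyticAt ℂ f (t + b * I) := fun t =>
    hfd.analyticAt (hopen.mem_nhds (hmem t))
  have hψan : ∀ t : ℝ, AnalyticAt ℂ ψ (t + b * I) := fun t =>
    hψd.analyticAt (hopen.mem_nhds (hmem t))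
  have hneg1 := strip_neg1 hℓ hb0 hb2 f hfper hfd u huc hu hu0 hfne
  -- winding of ψ on the level b
  have hψb : (∫ t in (0:ℝ)..ℓ, logDeriv ψ (t + b * I)) = 0 := by
    rw [← hwind]
    refine level_shift (a := Real.pi) (logDeriv ψ) ?_
      (fun z _ _ => logDeriv_per' ψ ℓ hψper z) ⟨hb0, hb2⟩ hy₀
    exact (hψd.deriv hopen).div hψd (fun z hz => hψ0 z hz.1 hz.2)
  set P : ℂ → ℂ := fun z => f z * ψ z with hP
  have hPper : Function.Antiperiodic P (ℓ : ℂ) := by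
    intro z
    simp only [hP, hfper z, hψper z, neg_mul]
  have hPint : (∫ t in (0:ℝ)..ℓ, logDeriv P (t + b * I)) =
      ∫ t in (0:ℝ)..ℓ, logDeriv f (t + b * I) := by
    have h1 : ∀ t : ℝ, logDeriv P (t + b * I) =
        logDeriv f (t + b * I) + logDeriv ψ (t + b * I) := fun t =>
      logDeriv_mul _ (hfne t) (hψne t) (hfan t).differentiableAt (hψan t).differentiableAt
    simp_rw [h1]
    rw [intervalIntegral.integral_add ((level_cont f b hfan hfne).intervalIntegrable _ _)
      ((level_cont ψ b hψan hψne).intervalIntegrable _ _), hψb, add_zero]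
  -- the reflected primitive
  set k : ℂ → ℂ := fun z => I * g (Real.pi * I - z) with hk
  have him : ∀ z : ℂ, (Real.pi * I - z).im = Real.pi - z.im := by intro z; simp
  have hkd : ∀ z : ℂ, 0 < z.im → z.im < ε →
      HasDerivAt k (-I * P (Real.pi * I - z)) z := by
    intro z h1 h2
    have h3 := hgd (Real.pi * I - z) (by rw [him]; linarith) (by rw [him]; linarith)
    have h4 : HasDerivAt (fun z : ℂ => Real.pi * I - z) (-1) z := by
      simpa using (hasDerivAt_id z).const_sub (Real.pi * I)
    have h5 := (HasDerivAt.comp z h3 h4).const_mul I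
    refine HasDerivAt.congr_deriv h5 ?_
    simp [hP]
  have hkper : Function.Antiperiodic k (ℓ : ℂ) := by
    intro z
    have h1 := hgper (Real.pi * I - (z + ℓ))
    have h2 : Real.pi * I - (z + ℓ) + ℓ = Real.pi * I - z := by ring
    rw [h2] at h1
    simp only [hk, h1]
    ring
  have hkuc : ContinuousOn (fun z : ℂ => - v (Real.pi * I - z))
      ({z : ℂ | 0 < z.im ∧ z.im < ε} ∪ {z : ℂ | z.im = 0}) := by
    refine (hvc.comp (by fun_prop) ?_).neg
    rintro z (hz | hz)
    · left
      have h1 := hz.1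
      have h2 := hz.2
      constructor
      · rw [him]; linarith
      · rw [him]; linarith
    · right
      have h1 : z.im = 0 := hz
      change (Real.pi * I - z).im = Real.pi
      rw [him, h1, sub_zero]
  have hbp : 0 < Real.pi - b := by linarith
  have hbε : Real.pi - b < ε := by linarith
  have hlev : ∀ t : ℝ, (Real.pi * I - ((t : ℂ) + (Real.pi - b : ℝ) * I)) =
      ((-t : ℝ) : ℂ) + b * I := by
    intro t; push_cast; ring
  have hlevim : ∀ t : ℝ, ((t : ℂ) + (Real.pi - b : ℝ) * I).im = Real.pi - b := by
    intro t; simp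
  have hkd' : ∀ t : ℝ, deriv k =ᶠ[𝓝 ((t : ℂ) + (Real.pi - b : ℝ) * I)]
      fun z => -I * P (Real.pi * I - z) := by
    intro t
    filter_upwards [level_strip (Real.pi - b) ε hbp hbε t] with z hz
    exact (hkd z hz.1 hz.2).deriv
  have hneg2 := strip_neg2 hℓ hbp hbε k hkper
    (fun z hz => (hkd z hz.1 hz.2).differentiableAt.differentiableWithinAt)
    (fun z : ℂ => - v (Real.pi * I - z)) hkuc
    (by
      intro z h1 h2
      rw [hv _ (by rw [him]; linarith) (by rw [him]; linarith)]
      simp [hk])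
    (by
      intro z hz
      rw [hv0 _ (by rw [him, hz, sub_zero]), neg_zero])
    (by
      intro t
      rw [(hkd' t).self_of_nhds]
      beta_reduce
      rw [hlev]
      exact mul_ne_zero (neg_ne_zero.2 I_ne_zero) (mul_ne_zero (hfne _) (hψne _)))
  have hpt : ∀ t : ℝ, logDeriv (deriv k) ((t : ℂ) + (Real.pi - b : ℝ) * I) =
      - logDeriv P (((-t : ℝ) : ℂ) + b * I) := by
    intro t
    have hPd : HasDerivAt P (deriv P (((-t : ℝ) : ℂ) + b * I)) (((-t : ℝ) : ℂ) + b * I) :=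
      ((hfan (-t)).differentiableAt.mul (hψan (-t)).differentiableAt).hasDerivAt
    have h4 : HasDerivAt (fun z : ℂ => Real.pi * I - z) (-1) ((t : ℂ) + (Real.pi - b : ℝ) * I) := by
      simpa using (hasDerivAt_id ((t : ℂ) + (Real.pi - b : ℝ) * I)).const_sub (Real.pi * I)
    rw [← hlev t] at hPd
    have h5 := (HasDerivAt.comp _ hPd h4).const_mul (-I)
    have h6 : deriv (fun z => -I * P (Real.pi * I - z)) ((t : ℂ) + (Real.pi - b : ℝ) * I) = _ :=
      h5.deriv
    rw [logDeriv_apply, (hkd' t).deriv_eq, (hkd' t).self_of_nhds, h6, logDeriv_apply]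
    simp only [hlev]
    have hPne : P (((-t : ℝ) : ℂ) + b * I) ≠ 0 := mul_ne_zero (hfne _) (hψne _)
    have := I_ne_zero
    field_simp
  have hLp : Function.Periodic (fun t : ℝ => logDeriv P (t + b * I)) ℓ := by
    intro t
    have h2 : ((t + ℓ : ℝ) : ℂ) + b * I = t + b * I + ℓ := by push_cast; ring
    simp only [h2]
    exact logDeriv_per P ℓ hPper _
  simp_rw [hpt] at hneg2
  rw [intervalIntegral.integral_neg,
    intervalIntegral.integral_comp_neg (fun t : ℝ => logDeriv P (t + b * I))] at hneg2
  have h7 := hLp.intervalIntegral_add_eq (-ℓ) 0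
  rw [neg_add_cancel, zero_add] at h7
  rw [neg_zero, h7, hPint, neg_im] at hneg2
  linarith

end Helpers

/-- uniqueness lemma (uniformized form of Lemma 3.1). -/
theorem stmt0 (ℓ : ℝ) (hℓ : 0 < ℓ) (ψ f : ℂ → ℂ)
    (hψd : DifferentiableOn ℂ ψ strip)
    (hψ0 : ∀ z ∈ strip, ψ z ≠ 0)
    (hψper : ∀ z : ℂ, z ∈ strip → z + (ℓ : ℂ) ∈ strip → ψ (z + (ℓ : ℂ)) = ψ z)
    (hwind : ∃ y₀ ∈ Set.Ioo (0 : ℝ) Real.pi,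
      (∫ t in (0 : ℝ)..ℓ, deriv ψ ((t : ℂ) + (y₀ : ℂ) * Complex.I) /
        ψ ((t : ℂ) + (y₀ : ℂ) * Complex.I)) = 0)
    (hfd : DifferentiableOn ℂ f strip)
    (hfper : ∀ z : ℂ, z ∈ strip → z + (ℓ : ℂ) ∈ strip → f (z + (ℓ : ℂ)) = -f z)
    (hRe : ∃ u : ℂ → ℝ,
      ContinuousOn u (strip ∪ {z : ℂ | z.im = 0}) ∧
      (∀ z ∈ strip, u z = (f z).re) ∧
      (∀ z : ℂ, z.im = 0 → u z = 0))
    (hIm : ∃ ε ∈ Set.Ioo (0 : ℝ) Real.pi, ∃ g : ℂ → ℂ, ∃ v : ℂ → ℝ,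
      (∀ z ∈ topStrip ε, HasDerivAt g (f z * ψ z) z) ∧
      (∀ z : ℂ, z ∈ topStrip ε → z + (ℓ : ℂ) ∈ topStrip ε → g (z + (ℓ : ℂ)) = -g z) ∧
      ContinuousOn v (topStrip ε ∪ {z : ℂ | z.im = Real.pi}) ∧
      (∀ z ∈ topStrip ε, v z = (g z).im) ∧
      (∀ z : ℂ, z.im = Real.pi → v z = 0)) :
    ∀ z ∈ strip, f z = 0 := by
  obtain ⟨y₀, hy₀, hw⟩ := hwind
  obtain ⟨u, huc, hu, hu0⟩ := hRe
  obtain ⟨ε, hε, g, v, hg, hgper, hvc, hv, hv0⟩ := hIm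
  have hopen : IsOpen strip :=
    (isOpen_lt continuous_const Complex.continuous_im).inter
      (isOpen_lt Complex.continuous_im continuous_const)
  have hopenT : IsOpen (topStrip ε) :=
    (isOpen_lt continuous_const Complex.continuous_im).inter
      (isOpen_lt Complex.continuous_im continuous_const)
  have hs : ∀ z : ℂ, z + (ℓ : ℂ) ∈ strip ↔ z ∈ strip := by
    intro z
    simp [strip]
  have hsT : ∀ z : ℂ, z + (ℓ : ℂ) ∈ topStrip ε ↔ z ∈ topStrip ε := by
    intro z
    simp [topStrip]
  have hTs : ∀ z ∈ topStrip ε, z ∈ strip := by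
    intro z hz
    have h1 := hz.1
    have h2 := hε.2
    exact ⟨by linarith, hz.2⟩
  have hψe : ∀ z ∈ strip, strip.indicator ψ =ᶠ[nhds z] ψ := by
    intro z hz
    filter_upwards [hopen.mem_nhds hz] with w hw
    exact Set.indicator_of_mem hw _
  have key := core ℓ hℓ (strip.indicator ψ) (strip.indicator f) ((topStrip ε).indicator g) ε y₀ u v
    hε.1 hε.2 hy₀
    (hψd.congr fun z hz => Set.indicator_of_mem hz _)
    (fun z h1 h2 => by
      have hz : z ∈ strip := ⟨h1, h2⟩
      rw [Set.indicator_of_mem hz]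
      exact hψ0 z hz)
    (by
      intro z
      by_cases hz : z ∈ strip
      · rw [Set.indicator_of_mem hz, Set.indicator_of_mem ((hs z).2 hz)]
        exact hψper z hz ((hs z).2 hz)
      · rw [Set.indicator_of_notMem hz, Set.indicator_of_notMem (fun h => hz ((hs z).1 h))])
    (by
      rw [← hw]
      apply intervalIntegral.integral_congr
      intro t _
      have hz : (t : ℂ) + y₀ * Complex.I ∈ strip := by
        constructor <;> simp [hy₀.1, hy₀.2]
      beta_reduce
      rw [logDeriv_apply, (hψe _ hz).deriv_eq, Set.indicator_of_mem hz])
    (hfd.congr fun z hz => Set.indicator_of_mem hz _)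
    (by
      intro z
      by_cases hz : z ∈ strip
      · rw [Set.indicator_of_mem hz, Set.indicator_of_mem ((hs z).2 hz)]
        exact hfper z hz ((hs z).2 hz)
      · rw [Set.indicator_of_notMem hz, Set.indicator_of_notMem (fun h => hz ((hs z).1 h)), neg_zero])
    huc
    (fun z h1 h2 => by
      have hz : z ∈ strip := ⟨h1, h2⟩
      rw [Set.indicator_of_mem hz]
      exact hu z hz)
    hu0
    (fun z h1 h2 => by
      have hz : z ∈ topStrip ε := ⟨h1, h2⟩
      rw [Set.indicator_of_mem (hTs z hz), Set.indicator_of_mem (hTs z hz)]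
      refine (hg z hz).congr_of_eventuallyEq ?_
      filter_upwards [hopenT.mem_nhds hz] with w hw
      exact Set.indicator_of_mem hw _)
    (by
      intro z
      by_cases hz : z ∈ topStrip ε
      · rw [Set.indicator_of_mem hz, Set.indicator_of_mem ((hsT z).2 hz)]
        exact hgper z hz ((hsT z).2 hz)
      · rw [Set.indicator_of_notMem hz, Set.indicator_of_notMem (fun h => hz ((hsT z).1 h)),
          neg_zero])
    hvc
    (fun z h1 h2 => by
      have hz : z ∈ topStrip ε := ⟨h1, h2⟩
      rw [Set.indicator_of_mem hz]
      exact hv z hz)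
    hv0
  intro z hz
  have := key z hz
  rwa [Set.indicator_of_mem hz] at this
end

section
/- Let ℓ > 0, S := {z ∈ ℂ : 0 < Im z < π}, and let φ : S → ℂ be an injective holomorphic map satisfying φ(z+ℓ) = φ(z) + 1 for all z with z, z+ℓ ∈ S. Then φ′ has no zeros in S, and for every y ∈ (0,π) the closed curve t ∈ [0,ℓ] ↦ φ′(t+iy) has winding number 0 around the origin; equivalently, ∫₀^ℓ (φ″/φ′)(t+iy) dt = 0. -/
theorem aux_deriv_ne_zero {f : ℂ → ℂ} {z₀ : ℂ} {U : Set ℂ} (hU : U ∈ nhds z₀)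
    (hf : AnalyticAt ℂ f z₀) (hinj : Set.InjOn f U) : deriv f z₀ ≠ 0 := by
  intro h0
  have hz₀U : z₀ ∈ U := mem_of_mem_nhds hU
  have hg : AnalyticAt ℂ (fun z => f z - f z₀) z₀ := hf.sub analyticAt_const
  have hnot : ¬ ∀ᶠ z in nhds z₀, f z - f z₀ = 0 := by
    intro h
    have h1 : ∀ᶠ z in nhdsWithin z₀ {z₀}ᶜ, f z - f z₀ = 0 ∧ z ∈ U ∧ z ∈ ({z₀}ᶜ : Set ℂ) :=
      (h.filter_mono nhdsWithin_le_nhds).and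
        ((Filter.Eventually.filter_mono nhdsWithin_le_nhds hU).and self_mem_nhdsWithin)
    obtain ⟨z, hz1, hz2, hz3⟩ := h1.exists
    exact hz3 (hinj hz2 hz₀U (sub_eq_zero.1 hz1))
  obtain ⟨n, h, hh, hh0, hev⟩ := hg.exists_eventuallyEq_pow_smul_nonzero_iff.2 hnot
  have hn0 : n ≠ 0 := by
    rintro rfl
    have := hev.self_of_nhds
    simp at this
    exact hh0 this.symm
  have hn1 : n ≠ 1 := by
    rintro rfl
    have h2 : HasDerivAt (fun z => (z - z₀) ^ 1 • h z) (h z₀) z₀ := by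
      have := (((hasDerivAt_id z₀).sub_const z₀)).mul hh.differentiableAt.hasDerivAt
      simp at this
      have e : (fun z => (z - z₀) ^ 1 • h z) = (fun x => x - z₀) * h := by
        ext z; simp
      rw [e]
      exact this
    have h3 : HasDerivAt (fun z => f z - f z₀) (deriv f z₀) z₀ :=
      hf.differentiableAt.hasDerivAt.sub_const _
    have := h3.unique (h2.congr_of_eventuallyEq hev)
    exact hh0 (by rw [← this, h0])
  have hnC : (n : ℂ) ≠ 0 := by exact_mod_cast hn0
  obtain ⟨c, hc⟩ : ∃ c : ℂ, c ^ n = h z₀ := IsAlgClosed.exists_pow_nat_eq _ (Nat.pos_of_ne_zero hn0)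
  have hc0 : c ≠ 0 := by
    rintro rfl
    rw [zero_pow hn0] at hc
    exact hh0 hc.symm
  set k : ℂ → ℂ := fun z => c * Complex.exp (Complex.log (h z / h z₀) / n) with hk
  have hkan : AnalyticAt ℂ k z₀ := by
    refine analyticAt_const.mul (AnalyticAt.cexp ?_)
    refine AnalyticAt.div ?_ analyticAt_const hnC
    refine AnalyticAt.clog (hh.div analyticAt_const hh0) ?_
    simp [hh0]
  have hk0 : k z₀ = c := by simp [hk, hh0]
  have hkne : ∀ z, k z ≠ 0 := fun z => mul_ne_zero hc0 (Complex.exp_ne_zero _)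
  have hkn : ∀ z, h z ≠ 0 → k z ^ n = h z := by
    intro z hz
    simp only [hk]
    rw [mul_pow, hc, ← Complex.exp_nat_mul, mul_div_cancel₀ _ hnC,
      Complex.exp_log (div_ne_zero hz hh0), mul_div_cancel₀ _ hh0]
  set u : ℂ → ℂ := fun z => (z - z₀) * k z with hu
  have huan : AnalyticAt ℂ u z₀ := (analyticAt_id.sub analyticAt_const).mul hkan
  have hud : HasStrictDerivAt u c z₀ := by
    have h1 : HasDerivAt u c z₀ := by
      have := (((hasDerivAt_id z₀).sub_const z₀)).mul hkan.differentiableAt.hasDerivAt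
      simp [hk0] at this
      exact this
    have := huan.hasStrictDerivAt
    rwa [h1.deriv] at this
  have hmap := hud.map_nhds_eq hc0
  have hu0 : u z₀ = 0 := by simp [hu]
  set ω : ℂ := Complex.exp (2 * Real.pi * Complex.I / n) with hω
  have hprim : IsPrimitiveRoot ω n := Complex.isPrimitiveRoot_exp n hn0
  have hω1 : ω ≠ 1 := hprim.ne_one (by omega)
  have hfu : ∀ᶠ z in nhds z₀, f z - f z₀ = u z ^ n := by
    filter_upwards [hev, hh.continuousAt.eventually_ne hh0] with z hz hz'
    rw [hz, hu]
    simp only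
    rw [mul_pow, hkn z hz', smul_eq_mul]
  set V : Set ℂ := {z | z ∈ U ∧ f z - f z₀ = u z ^ n} with hV
  have hVn : V ∈ nhds z₀ := Filter.Eventually.and hU hfu
  have himg : u '' V ∈ nhds (0:ℂ) := by
    rw [← hu0, ← hmap]
    exact Filter.image_mem_map hVn
  have htend : Filter.Tendsto (fun z => ω * u z) (nhds z₀) (nhds 0) := by
    have : ContinuousAt (fun z => ω * u z) z₀ := continuousAt_const.mul huan.continuousAt
    have h2 : Filter.Tendsto (fun z => ω * u z) (nhds z₀) (nhds (ω * u z₀)) := this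
    rwa [hu0, mul_zero] at h2
  have h1 : ∀ᶠ z in nhdsWithin z₀ {z₀}ᶜ, z ∈ V ∧ ω * u z ∈ u '' V ∧ z ∈ ({z₀}ᶜ : Set ℂ) :=
    (Filter.Eventually.filter_mono nhdsWithin_le_nhds hVn).and
      (((htend.eventually himg).filter_mono nhdsWithin_le_nhds).and self_mem_nhdsWithin)
  obtain ⟨z, hz1, ⟨w, hw, hwu⟩, hz3⟩ := h1.exists
  have hfe : f w = f z := by
    have e1 := hz1.2
    have e2 := hw.2
    rw [hwu, mul_pow, hprim.pow_eq_one, one_mul, ← e1] at e2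
    exact sub_left_inj.1 e2
  have hwz := hinj hw.1 hz1.1 hfe
  rw [hwz] at hwu
  have huz : u z ≠ 0 := mul_ne_zero (sub_ne_zero.2 hz3) (hkne z)
  exact hω1 (mul_right_cancel₀ huz (by rw [one_mul]; exact hwu.symm))

theorem aux_log_deriv {c g : ℝ → ℂ} (hc : Continuous c) (hcg : ∀ x, Complex.exp (c x) = g x)
    {x : ℝ} {g' : ℂ} (hg : HasDerivAt g g' x) : HasDerivAt c (g' / g x) x := by
  have hgx : g x ≠ 0 := by rw [← hcg]; exact Complex.exp_ne_zero _
  have h1 : HasDerivAt (fun t => Complex.log (g t / g x) + c x) (g' / g x) x := by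
    have := ((hg.div_const (g x)).clog_real (by simp [hgx])).add_const (c x)
    simpa [hgx] using this
  refine h1.congr_of_eventuallyEq ?_
  have h2 : ∀ᶠ t in nhds x, ‖c t - c x‖ < Real.pi := by
    have : Continuous fun t => ‖c t - c x‖ := by fun_prop
    refine this.continuousAt.eventually_lt continuousAt_const ?_
    simpa using Real.pi_pos
  filter_upwards [h2] with t ht
  have him := (abs_le.1 ((Complex.abs_im_le_norm (c t - c x))))
  rw [← hcg t, ← hcg x, ← Complex.exp_sub, Complex.log_exp (by linarith) (by linarith)]
  ring

theorem aux_log_const {c : ℝ → ℂ} (hc : Continuous c) {a : ℂ} (hca : ∀ x, Complex.exp (c x) = a)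
    (x y : ℝ) : c x = c y := by
  have h : ∀ t, HasDerivAt c 0 t := fun t => by
    simpa using aux_log_deriv hc hca (hasDerivAt_const t a)
  exact is_const_of_deriv_eq_zero (fun t => (h t).differentiableAt) (fun t => (h t).deriv) x y

theorem aux_winding (ℓ : ℝ) (hℓ : 0 < ℓ) (f ψ ψ' : ℝ → ℂ) (hf : ∀ x, HasDerivAt f (ψ x) x)
    (hψ : ∀ x, HasDerivAt ψ (ψ' x) x) (hψ' : Continuous ψ') (hinj : Function.Injective f)
    (hper : ∀ x, f (x + ℓ) = f x + 1) (hne : ∀ x, ψ x ≠ 0) :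
    ∫ t in (0:ℝ)..ℓ, ψ' t / ψ t = 0 := by
  have hψc : Continuous ψ := continuous_iff_continuousAt.2 fun x => (hψ x).continuousAt
  have hψper : ∀ x, ψ (x + ℓ) = ψ x := by
    intro x
    have h1 : HasDerivAt (fun x => f (x + ℓ)) (ψ (x + ℓ)) x := (hf (x + ℓ)).comp_add_const x ℓ
    have h2 : HasDerivAt (fun x => f (x + ℓ)) (ψ x) x := by
      rw [funext hper]
      exact (hf x).add_const 1
    exact h1.unique h2
  set F : ℝ × ℝ → ℂ := fun p => ∫ u in (0:ℝ)..1, ψ (p.1 + u * p.2) with hF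
  have hFc : Continuous F := by
    refine intervalIntegral.continuous_parametric_intervalIntegral_of_continuous' ?_ _ _
    simp only [Function.uncurry_def]
    fun_prop
  have hFmul : ∀ t s : ℝ, (s : ℂ) * F (t, s) = f (t + s) - f t := by
    intro t s
    have h1 : ∀ u ∈ Set.uIcc (0:ℝ) 1,
        HasDerivAt (fun u => f (t + u * s)) ((s : ℂ) * ψ (t + u * s)) u := by
      intro u _
      have h2 : HasDerivAt (fun u : ℝ => t + u * s) s u := by
        simpa using ((hasDerivAt_id u).mul_const s).const_add t
      have := (hf (t + u * s)).scomp u h2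
      simpa [Function.comp_def] using this
    have h3 := intervalIntegral.integral_eq_sub_of_hasDerivAt h1
      (Continuous.intervalIntegrable (by fun_prop) _ _)
    rw [intervalIntegral.integral_const_mul] at h3
    simpa [hF] using h3
  have hF0 : ∀ t, F (t, 0) = ψ t := by intro t; simp [hF]
  have hℓC : (ℓ : ℂ) ≠ 0 := by exact_mod_cast hℓ.ne'
  have hFℓ : ∀ t, F (t, ℓ) = 1 / ℓ := by
    intro t
    rw [eq_div_iff hℓC, mul_comm, hFmul, hper]
    ring
  have hFper : ∀ s, F (ℓ, s) = F (0, s) := by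
    intro s
    simp only [hF]
    congr 1
    ext u
    rw [← hψper (0 + u * s)]
    congr 1
    ring
  have hFne : ∀ p, F p ≠ 0 := by
    rintro ⟨t, s⟩ h0
    by_cases hs : s = 0
    · subst hs
      rw [hF0] at h0
      exact hne t h0
    · have := hFmul t s
      rw [h0, mul_zero] at this
      have := hinj (sub_eq_zero.1 this.symm)
      exact hs (by linarith)
  obtain ⟨H, ⟨-, hH⟩, -⟩ := Complex.isCoveringMapOn_exp.existsUnique_continuousMap_lifts
    (⟨F, hFc⟩ : C(ℝ × ℝ, ℂ)) (a₀ := (0, 0)) (e₀ := Complex.log (F (0, 0)))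
    (Complex.exp_log (hFne _)) (fun p => hFne p)
  have hHe : ∀ p, Complex.exp (H p) = F p := fun p => congrFun hH p
  have hHc : Continuous H := H.continuous
  have e1 : H (ℓ, 0) - H (0, 0) = H (ℓ, ℓ) - H (0, ℓ) := by
    refine aux_log_const (c := fun s => H (ℓ, s) - H (0, s)) (a := 1) (by fun_prop) ?_ 0 ℓ
    intro s
    rw [Complex.exp_sub, hHe, hHe, hFper, div_self (hFne _)]
  have e2 : H (ℓ, ℓ) = H (0, ℓ) :=
    aux_log_const (c := fun t => H (t, ℓ)) (a := 1 / ℓ) (by fun_prop)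
      (fun t => by rw [hHe, hFℓ]) ℓ 0
  have hd : ∀ t ∈ Set.uIcc (0:ℝ) ℓ, HasDerivAt (fun t => H (t, 0)) (ψ' t / ψ t) t :=
    fun t _ => aux_log_deriv (by fun_prop) (fun t => by rw [hHe, hF0]) (hψ t)
  rw [intervalIntegral.integral_eq_sub_of_hasDerivAt hd
    ((hψ'.div hψc hne).intervalIntegrable _ _), e1, e2, sub_self]


open Complex

/-- the derivative of a conformal parametrization of the cylinder is zero-free
and its horizontal loops have winding number 0 around the origin. -/
theorem stmt1 (ℓ : ℝ) (hℓ : 0 < ℓ) (φ : ℂ → ℂ)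
    (hd : DifferentiableOn ℂ φ strip)
    (hinj : Set.InjOn φ strip)
    (hper : ∀ z : ℂ, z ∈ strip → z + (ℓ : ℂ) ∈ strip → φ (z + (ℓ : ℂ)) = φ z + 1) :
    (∀ z ∈ strip, deriv φ z ≠ 0) ∧
    ∀ y ∈ Set.Ioo (0 : ℝ) Real.pi,
      (∫ t in (0 : ℝ)..ℓ, deriv (deriv φ) ((t : ℂ) + (y : ℂ) * Complex.I) /
        deriv φ ((t : ℂ) + (y : ℂ) * Complex.I)) = 0 := by
  have hopen : IsOpen strip :=
    (isOpen_lt continuous_const Complex.continuous_im).inter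
      (isOpen_lt Complex.continuous_im continuous_const)
  have han : ∀ z ∈ strip, AnalyticAt ℂ φ z := fun z hz => hd.analyticAt (hopen.mem_nhds hz)
  have hne : ∀ z ∈ strip, deriv φ z ≠ 0 := fun z hz =>
    aux_deriv_ne_zero (hopen.mem_nhds hz) (han z hz) hinj
  refine ⟨hne, ?_⟩
  intro y hy
  have hmem : ∀ t : ℝ, (t : ℂ) + (y : ℂ) * Complex.I ∈ strip := by
    intro t
    simpa [strip] using hy
  have hline : ∀ t : ℝ, HasDerivAt (fun t : ℝ => (t : ℂ) + (y : ℂ) * Complex.I) 1 t := fun t =>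
    (Complex.ofRealCLM.hasDerivAt (x := t)).add_const _
  have hcomp : ∀ (g : ℂ → ℂ), (∀ z ∈ strip, AnalyticAt ℂ g z) → ∀ t : ℝ,
      HasDerivAt (fun t : ℝ => g ((t : ℂ) + (y : ℂ) * Complex.I))
        (deriv g ((t : ℂ) + (y : ℂ) * Complex.I)) t := by
    intro g hg t
    have := (hg _ (hmem t)).differentiableAt.hasDerivAt.comp t (hline t)
    simpa [Function.comp_def] using this
  refine aux_winding ℓ hℓ (fun t => φ ((t : ℂ) + (y : ℂ) * Complex.I)) _ _ (hcomp φ han)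
    (hcomp (deriv φ) fun z hz => (han z hz).deriv) ?_ ?_ ?_ (fun t => hne _ (hmem t))
  · exact continuous_iff_continuousAt.2 fun t =>
      (hcomp (deriv (deriv φ)) (fun z hz => (han z hz).deriv.deriv) t).continuousAt
  · intro a b hab
    have := hinj (hmem a) (hmem b) hab
    exact_mod_cast add_right_cancel this
  · intro t
    have e : (((t + ℓ : ℝ) : ℂ) + (y : ℂ) * Complex.I) = (t : ℂ) + (y : ℂ) * Complex.I + ℓ := by
      push_cast; ring
    have := hmem (t + ℓ)
    simp only [e] at this ⊢
    exact hper _ (hmem t) this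
end

section
/- Let ℓ > 0 and μ ∈ ℝ, set τ := 2πi/ℓ, and assume θ₃(μ;τ) ≠ 0. Then for all m, n ∈ ℤ, the function g_μ has a simple pole at w = m + nτ with residue (−1)^{m+n}·e^{−2πinμ}·(2/(πi)); that is, lim_{w→m+nτ} (w − m − nτ)·g_μ(w) = (−1)^{m+n}·e^{−2πinμ}·(2/(πi)). -/
open Complex

lemma aux_theta3 (τ w : ℂ) : theta3 τ w = jacobiTheta₂ w τ := by
  unfold theta3 jacobiTheta₂ jacobiTheta₂_term
  refine tsum_congr fun n => ?_
  rw [← Complex.exp_add]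
  ring_nf

lemma aux_neg_one_zpow (n : ℤ) : (-1 : ℂ) ^ n = Complex.exp (Real.pi * Complex.I * n) := by
  rw [← Complex.exp_pi_mul_I, ← Complex.exp_int_mul]
  ring_nf

lemma aux_theta1 (τ w : ℂ) : theta1 τ w =
    -Complex.I * Complex.exp (Real.pi * Complex.I * τ / 4) *
      (Complex.exp (Real.pi * Complex.I * w) * jacobiTheta₂ (w + (1 + τ) / 2) τ) := by
  unfold theta1 jacobiTheta₂ jacobiTheta₂_term
  rw [mul_assoc (-Complex.I)]
  congr 1
  rw [← tsum_mul_left, ← tsum_mul_left]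
  refine tsum_congr fun n => ?_
  rw [aux_neg_one_zpow]
  simp only [← Complex.exp_add]
  ring_nf

lemma aux_shift (z τ : ℂ) (m n : ℤ) : jacobiTheta₂ (z + (m + n * τ)) τ =
    Complex.exp (-Real.pi * Complex.I * (n ^ 2 * τ + 2 * n * z)) * jacobiTheta₂ z τ := by
  conv_rhs => rw [jacobiTheta₂, ← tsum_mul_left, ← (Equiv.addRight n).tsum_eq]
  refine tsum_congr fun k => ?_
  have h : Complex.exp (2 * Real.pi * Complex.I * k * m) = 1 := by
    have := Complex.exp_int_mul_two_pi_mul_I (k * m)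
    rw [← this]; push_cast; ring_nf
  simp_rw [jacobiTheta₂_term, ← Complex.exp_add, Equiv.coe_addRight, Int.cast_add]
  rw [← mul_one (Complex.exp (-Real.pi * _ * _ + _)), ← h, ← Complex.exp_add]
  ring_nf

lemma aux_zero (τ : ℂ) : jacobiTheta₂ ((1 + τ) / 2) τ = 0 := by
  have h := aux_shift (-((1 + τ) / 2)) τ 1 1
  rw [jacobiTheta₂_neg_left] at h
  have e1 : -((1 + τ) / 2) + (((1 : ℤ) : ℂ) + ((1 : ℤ) : ℂ) * τ) = (1 + τ) / 2 := by
    push_cast; ring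
  have e2 : -Real.pi * Complex.I * (((1 : ℤ) : ℂ) ^ 2 * τ + 2 * ((1 : ℤ) : ℂ) * -((1 + τ) / 2))
      = Real.pi * Complex.I := by push_cast; ring
  rw [e1, e2, Complex.exp_pi_mul_I] at h
  linear_combination h / 2

lemma aux_big (t : ℝ) (ht : 1 ≤ t) :
    jacobiTheta₂' ((1 + t * Complex.I) / 2) (t * Complex.I) ≠ 0 := by
  intro h0
  have him : 0 < (t * Complex.I : ℂ).im := by simp; linarith
  have hs := (hasSum_jacobiTheta₂'_term ((1 + t * Complex.I) / 2) him)
  rw [h0] at hs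
  set x : ℝ := Real.exp (-(Real.pi * t)) with hx
  have hx0 : 0 < x := Real.exp_pos _
  have hx3 : x ≤ 1 / 3 := by
    rw [hx, Real.exp_neg, ← one_div]
    have h1 := Real.add_one_le_exp (Real.pi * t)
    have h2 := Real.pi_gt_three
    apply one_div_le_one_div_of_le (by norm_num)
    nlinarith
  have hterm : ∀ n : ℤ, jacobiTheta₂'_term n ((1 + t * Complex.I) / 2) (t * Complex.I) =
      2 * Real.pi * Complex.I * n * ((-1 : ℂ) ^ n * ((x : ℂ) ^ (n * (n + 1)))) := by
    intro n
    rw [jacobiTheta₂'_term, jacobiTheta₂_term, aux_neg_one_zpow, hx, Complex.ofReal_exp,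
      ← Complex.exp_int_mul, ← Complex.exp_add]
    congr 2
    push_cast
    linear_combination (Real.pi * n * (n + 1) * t : ℂ) * Complex.I_sq
  have hs2 := hs.nat_add_neg_add_one
  have hp : ∀ n : ℕ, jacobiTheta₂'_term n ((1 + t * Complex.I) / 2) (t * Complex.I) +
      jacobiTheta₂'_term (-(n + 1)) ((1 + t * Complex.I) / 2) (t * Complex.I) =
      2 * Real.pi * Complex.I * (2 * n + 1) * ((-1 : ℂ) ^ n * (x : ℂ) ^ (n * (n + 1))) := by
    intro n
    rw [hterm, hterm]
    have e1 : (-((n : ℤ) + 1)) * (-((n : ℤ) + 1) + 1) = ((n * (n + 1) : ℕ) : ℤ) := by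
      push_cast; ring
    have e2 : (n : ℤ) * ((n : ℤ) + 1) = ((n * (n + 1) : ℕ) : ℤ) := by push_cast; ring
    have e3 : (-1 : ℂ) ^ (-((n : ℤ) + 1)) = -(-1) ^ n := by
      rw [zpow_neg, ← inv_zpow, inv_neg, inv_one, zpow_add₀ (by norm_num), zpow_natCast]
      simp
    rw [e1, e2, e3, zpow_natCast, zpow_natCast]
    push_cast
    ring
  simp only [hp] at hs2
  have hs3 := (hasSum_nat_add_iff' 1).mpr hs2
  have hg : HasSum (fun n : ℕ => 2 * Real.pi * (1 / 3) * (1 / 3 : ℝ) ^ n)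
      (2 * Real.pi * (1 / 3) * (1 - 1 / 3)⁻¹) :=
    (hasSum_geometric_of_lt_one (by norm_num) (by norm_num)).mul_left _
  have hb := hs3.norm_le_of_bounded hg (by
    intro n
    simp only [norm_mul, norm_pow, norm_neg, norm_one, one_pow, one_mul, Complex.norm_I, mul_one,
      Complex.norm_real, Real.norm_eq_abs, abs_of_pos hx0, abs_of_pos Real.pi_pos, Complex.norm_two]
    have e : ‖(2 * ((n + 1 : ℕ) : ℂ) + 1)‖ = 2 * n + 3 := by
      have : (2 * ((n + 1 : ℕ) : ℂ) + 1) = ((2 * n + 3 : ℕ) : ℂ) := by push_cast; ring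
      rw [this, Complex.norm_natCast]; push_cast; ring
    rw [e]
    have h3 : (2 * n + 3 : ℝ) ≤ 3 ^ (n + 1) := by
      have := one_add_mul_le_pow (a := (2 : ℝ)) (by norm_num) (n + 1)
      norm_num at this
      linarith
    have h4 : x ^ ((n + 1) * (n + 1 + 1)) ≤ (1 / 3 : ℝ) ^ ((n + 1) * 2) :=
      (pow_le_pow_left₀ hx0.le hx3 _).trans
        (pow_le_pow_of_le_one (by norm_num) (by norm_num) (by nlinarith))
    calc 2 * Real.pi * (2 * n + 3) * x ^ ((n + 1) * (n + 1 + 1))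
        ≤ 2 * Real.pi * 3 ^ (n + 1) * (1 / 3 : ℝ) ^ ((n + 1) * 2) := by
          have := Real.pi_pos
          gcongr
      _ = 2 * Real.pi * (3 * (1 / 3 : ℝ) ^ 2) ^ (n + 1) := by
          rw [mul_pow, ← pow_mul, mul_comm (n + 1) 2]; ring
      _ = _ := by norm_num [pow_succ]; ring)
  simp at hb
  rw [abs_of_pos Real.pi_pos] at hb
  have := Real.pi_pos
  norm_num at hb
  nlinarith

lemma aux_small (τ : ℂ) (hτ : τ ≠ 0)
    (h : jacobiTheta₂' ((1 + -1 / τ) / 2) (-1 / τ) ≠ 0) :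
    jacobiTheta₂' ((1 + τ) / 2) τ ≠ 0 := by
  rw [jacobiTheta₂'_functional_equation]
  have e : (1 + τ) / 2 / τ = -((1 + -1 / τ) / 2) + 1 := by field_simp; ring
  rw [e, jacobiTheta₂'_add_left, jacobiTheta₂_add_left, jacobiTheta₂'_neg_left,
    jacobiTheta₂_neg_left, aux_zero, mul_zero, sub_zero]
  refine mul_ne_zero (div_ne_zero (mul_ne_zero (one_div_ne_zero ?_) (Complex.exp_ne_zero _)) hτ)
    (neg_ne_zero.mpr h)
  rw [Complex.cpow_ne_zero_iff]
  left
  simp [hτ]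

lemma aux_J (t : ℝ) (ht : 0 < t) :
    jacobiTheta₂' ((1 + t * Complex.I) / 2) (t * Complex.I) ≠ 0 := by
  rcases le_total 1 t with h | h
  · exact aux_big t h
  · have ht' : (t : ℂ) ≠ 0 := by exact_mod_cast ht.ne'
    refine aux_small _ (mul_ne_zero ht' Complex.I_ne_zero) ?_
    have e : -1 / (t * Complex.I) = ((1 / t : ℝ) : ℂ) * Complex.I := by
      push_cast
      field_simp
      simp
    rw [e]
    exact aux_big _ (by rw [le_div_iff₀ ht]; linarith)

lemma aux_theta1_shift (τ w : ℂ) (m n : ℤ) : theta1 τ (w + (m + n * τ)) =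
    (-1 : ℂ) ^ (m + n) * Complex.exp (-Real.pi * Complex.I * (n ^ 2 * τ + 2 * n * w)) *
      theta1 τ w := by
  rw [aux_theta1, aux_theta1, add_right_comm, aux_shift, aux_neg_one_zpow]
  have h : Complex.exp (2 * Real.pi * Complex.I * n) = 1 := by
    rw [← Complex.exp_int_mul_two_pi_mul_I n]; ring_nf
  have key : Complex.exp (Real.pi * Complex.I * (w + (m + n * τ))) *
      Complex.exp (-Real.pi * Complex.I * (n ^ 2 * τ + 2 * n * (w + (1 + τ) / 2))) =
      Complex.exp (Real.pi * Complex.I * ((m + n : ℤ) : ℂ)) *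
      Complex.exp (-Real.pi * Complex.I * (n ^ 2 * τ + 2 * n * w)) *
      Complex.exp (Real.pi * Complex.I * w) := by
    refine (mul_one _).symm.trans ((congrArg _ h.symm).trans ?_)
    simp only [← Complex.exp_add]
    push_cast
    ring_nf
  linear_combination (-Complex.I * Complex.exp (Real.pi * Complex.I * τ / 4) *
    jacobiTheta₂ (w + (1 + τ) / 2) τ) * key

lemma aux_gmu_shift (ℓ μ : ℝ) (w : ℂ) (m n : ℤ) : gmu ℓ μ (w + (m + n * tau ℓ)) =
    (-1 : ℂ) ^ (m + n) * Complex.exp (-(2 * Real.pi * Complex.I * (n : ℂ) * (μ : ℂ))) *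
      gmu ℓ μ w := by
  unfold gmu
  rw [aux_theta1_shift, aux_theta3, add_right_comm, aux_shift, ← aux_theta3]
  have e : Complex.exp (-Real.pi * Complex.I * (n ^ 2 * tau ℓ + 2 * n * (w + μ))) =
      Complex.exp (-(2 * Real.pi * Complex.I * (n : ℂ) * (μ : ℂ))) *
      Complex.exp (-Real.pi * Complex.I * (n ^ 2 * tau ℓ + 2 * n * w)) := by
    rw [← Complex.exp_add]; ring_nf
  rw [e]
  have hE := Complex.exp_ne_zero (-Real.pi * Complex.I * (n ^ 2 * tau ℓ + 2 * n * w))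
  have hs : ((-1 : ℂ) ^ (m + n))⁻¹ = (-1 : ℂ) ^ (m + n) := by
    rw [← inv_zpow, inv_neg, inv_one]
  generalize Complex.exp (-Real.pi * Complex.I * (n ^ 2 * tau ℓ + 2 * n * w)) = E at *
  simp only [div_eq_mul_inv, mul_inv, hs]
  linear_combination (2 * (((Real.pi : ℂ)⁻¹ * Complex.I⁻¹) * deriv (theta1 (tau ℓ)) 0) *
    Complex.exp (-(2 * Real.pi * Complex.I * (n : ℂ) * (μ : ℂ))) * theta3 (tau ℓ) (w + μ) *
    (theta3 (tau ℓ) μ)⁻¹ * (-1 : ℂ) ^ (m + n) * (theta1 (tau ℓ) w)⁻¹) * (mul_inv_cancel₀ hE)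

open scoped Topology in
lemma aux_main (ℓ μ : ℝ) (hℓ : 0 < ℓ) (hμ : theta3 (tau ℓ) (μ : ℂ) ≠ 0) :
    Filter.Tendsto (fun w : ℂ => w * gmu ℓ μ w) (𝓝[≠] 0) (𝓝 (2 / (Real.pi * Complex.I))) := by
  have ht : 0 < 2 * Real.pi / ℓ := by have := Real.pi_pos; positivity
  have hτ : tau ℓ = ((2 * Real.pi / ℓ : ℝ) : ℂ) * Complex.I := by
    unfold tau; push_cast; ring
  have him : 0 < (tau ℓ).im := by rw [hτ]; simpa using ht
  have hJ : jacobiTheta₂' ((1 + tau ℓ) / 2) (tau ℓ) ≠ 0 := by rw [hτ]; exact aux_J _ ht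
  have hz : theta1 (tau ℓ) 0 = 0 := by rw [aux_theta1, zero_add, aux_zero]; simp
  have hd : HasDerivAt (theta1 (tau ℓ))
      (-Complex.I * Complex.exp (Real.pi * Complex.I * tau ℓ / 4) *
        jacobiTheta₂' ((1 + tau ℓ) / 2) (tau ℓ)) 0 := by
    have hfun : theta1 (tau ℓ) = fun w => -Complex.I * Complex.exp (Real.pi * Complex.I * tau ℓ / 4)
      * (Complex.exp (Real.pi * Complex.I * w) * jacobiTheta₂ (w + (1 + tau ℓ) / 2) (tau ℓ)) :=
      funext fun w => aux_theta1 _ w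
    rw [hfun]
    have h1 : HasDerivAt (fun w : ℂ => jacobiTheta₂ (w + (1 + tau ℓ) / 2) (tau ℓ))
        (jacobiTheta₂' ((1 + tau ℓ) / 2) (tau ℓ)) 0 := by
      have := hasDerivAt_jacobiTheta₂_fst (0 + (1 + tau ℓ) / 2) him
      have := this.comp_add_const 0 ((1 + tau ℓ) / 2)
      simpa using this
    have h2 : HasDerivAt (fun w : ℂ => Complex.exp (Real.pi * Complex.I * w))
        (Complex.exp (Real.pi * Complex.I * 0) * (Real.pi * Complex.I * 1)) 0 :=
      ((hasDerivAt_id (0 : ℂ)).const_mul (Real.pi * Complex.I)).cexp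
    have h3 := (h2.mul h1).const_mul (-Complex.I * Complex.exp (Real.pi * Complex.I * tau ℓ / 4))
    rw [zero_add, aux_zero] at h3
    simpa using! h3
  set D := deriv (theta1 (tau ℓ)) 0 with hD
  have hD0 : D ≠ 0 := by
    rw [hD, hd.deriv]
    exact mul_ne_zero (mul_ne_zero (neg_ne_zero.mpr Complex.I_ne_zero) (Complex.exp_ne_zero _)) hJ
  have hsl := hd.differentiableAt.hasDerivAt.tendsto_slope
  rw [← hD] at hsl
  have hc : Filter.Tendsto (fun w : ℂ => theta3 (tau ℓ) (w + μ)) (𝓝[≠] 0)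
      (𝓝 (theta3 (tau ℓ) μ)) := by
    have h1 : ContinuousAt (fun w : ℂ => theta3 (tau ℓ) (w + μ)) 0 := by
      simp only [aux_theta3]
      have := (hasDerivAt_jacobiTheta₂_fst (0 + (μ : ℂ)) him).comp_add_const 0 (μ : ℂ)
      exact this.continuousAt
    have := h1.tendsto
    rw [zero_add] at this
    exact this.mono_left nhdsWithin_le_nhds
  have hfin := ((hc.const_mul (2 / (Real.pi * Complex.I) * D)).div_const
    (theta3 (tau ℓ) μ)).div hsl hD0
  have e : 2 / (Real.pi * Complex.I) * D * theta3 (tau ℓ) μ / theta3 (tau ℓ) μ / D =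
      2 / (Real.pi * Complex.I) := by field_simp
  rw [e] at hfin
  refine hfin.congr fun w => ?_
  simp only [Pi.div_apply, slope_def_field, hz, sub_zero, gmu, ← hD]
  simp only [div_eq_mul_inv, mul_inv, inv_inv]
  ring

open scoped Topology in
/-- `g_μ` has a simple pole at each lattice point `m + nτ` with residue
`(−1)^{m+n} e^{−2πinμ} · 2/(πi)`. -/
theorem stmt3 (ℓ μ : ℝ) (hℓ : 0 < ℓ)
    (hμ : theta3 (tau ℓ) (μ : ℂ) ≠ 0) (m n : ℤ) :
    Filter.Tendsto
      (fun w : ℂ => (w - ((m : ℂ) + (n : ℂ) * tau ℓ)) * gmu ℓ μ w)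
      (𝓝[≠] ((m : ℂ) + (n : ℂ) * tau ℓ))
      (𝓝 ((-1 : ℂ) ^ (m + n) * Complex.exp (-(2 * Real.pi * Complex.I * (n : ℂ) * (μ : ℂ)))
        * (2 / (Real.pi * Complex.I)))) := by
  have hsub : Filter.Tendsto (fun w : ℂ => w - ((m : ℂ) + (n : ℂ) * tau ℓ))
      (𝓝[≠] ((m : ℂ) + (n : ℂ) * tau ℓ)) (𝓝[≠] 0) := by
    refine tendsto_nhdsWithin_iff.mpr ⟨?_, ?_⟩
    · have : ContinuousAt (fun w : ℂ => w - ((m : ℂ) + (n : ℂ) * tau ℓ))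
        ((m : ℂ) + (n : ℂ) * tau ℓ) := by fun_prop
      have := this.tendsto
      rw [sub_self] at this
      exact this.mono_left nhdsWithin_le_nhds
    · filter_upwards [self_mem_nhdsWithin] with w hw
      exact sub_ne_zero.mpr hw
  have h := ((aux_main ℓ μ hℓ hμ).comp hsub).const_mul
    ((-1 : ℂ) ^ (m + n) * Complex.exp (-(2 * Real.pi * Complex.I * (n : ℂ) * (μ : ℂ))))
  refine h.congr fun w => ?_
  have hs := aux_gmu_shift ℓ μ (w - ((m : ℂ) + (n : ℂ) * tau ℓ)) m n
  rw [sub_add_cancel] at hs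
  rw [hs]
  simp only [Function.comp]
  ring
end
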